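/- arXiv:1302.0814 — 5 statements merged into one kernel-verified Lean document; each statement's English description precedes it below -/
import Mathlib

section
/- Let d ≥ 1 be an integer, β ≠ 0 and p real numbers, and set κ = 1+β(p−2). Let u : ℝ × ℝ^d → ℝ be smooth, with u(t,x) > 0 for all (t,x), ℤ^d-periodic in x, and satisfying the flow equation ∂ₜu = u^{2−2β}·(Δₓu + κ·|∇ₓu|²/u). Then the function t ↦ ∫_{[0,1]^d} u(t,x)^{βp} dx is constant (its derivative is zero for every t). -/
open MeasureTheory

/-- The i-th partial derivative of f : ℝ^d → ℝ. -/
noncomputable def pd {d : ℕ} (i : Fin d) (f : (Fin d → ℝ) → ℝ) (x : Fin d → ℝ) : ℝ :=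
  fderiv ℝ f x (Pi.single i 1)

/-- The Laplacian of f : ℝ^d → ℝ. -/
noncomputable def lap {d : ℕ} (f : (Fin d → ℝ) → ℝ) (x : Fin d → ℝ) : ℝ :=
  ∑ i, pd i (pd i f) x

/-- Differentiation under the integral sign for a `C¹` integrand over a compact set. -/
theorem hasDerivAt_setIntegral_of_contDiff {E : Type*} [NormedAddCommGroup E] [NormedSpace ℝ E]
    [MeasurableSpace E] [BorelSpace E] {μ : Measure E} [IsFiniteMeasureOnCompacts μ]
    {F : ℝ × E → ℝ} (hF : ContDiff ℝ 1 F) {K : Set E} (hK : IsCompact K) (t : ℝ) :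
    HasDerivAt (fun s => ∫ x in K, F (s, x) ∂μ) (∫ x in K, deriv (fun s => F (s, x)) t ∂μ) t := by
  have hderiv (s : ℝ) (x : E) :
      HasDerivAt (fun r => F (r, x)) (fderiv ℝ F (s, x) (1, 0)) s :=
    ((hF.differentiable one_ne_zero) (s, x)).hasFDerivAt.comp_hasDerivAt s
      ((hasDerivAt_id s).prodMk (hasDerivAt_const s x))
  have hcont : Continuous fun z : ℝ × E => fderiv ℝ F z (1, 0) :=
    (hF.continuous_fderiv one_ne_zero).clm_apply continuous_const
  have hint {g : ℝ × E → ℝ} (hg : Continuous g) (s : ℝ) :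
      IntegrableOn (fun x => g (s, x)) K μ :=
    (hg.comp (Continuous.prodMk_right s)).continuousOn.integrableOn_compact hK
  obtain ⟨C, hC⟩ := ((isCompact_closedBall t 1).prod hK).exists_bound_of_continuousOn
    hcont.continuousOn
  simp_rw [fun x => (hderiv t x).deriv]
  refine (hasDerivAt_integral_of_dominated_loc_of_deriv_le (bound := fun _ => C)
    (F' := fun s x => fderiv ℝ F (s, x) (1, 0)) (Metric.closedBall_mem_nhds t one_pos)
    (.of_forall fun s => (hint hF.continuous s).aestronglyMeasurable)
    (hint hF.continuous t) (hint hcont t).aestronglyMeasurable ?_ ?_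
    (.of_forall fun x s _ => hderiv s x)).2
  · filter_upwards [ae_restrict_mem hK.measurableSet] with x hx s hs
    exact hC (s, x) ⟨hs, hx⟩
  · exact integrableOn_const hK.measure_lt_top.ne

/-- The divergence of a `C¹` vector field which is periodic in each direction integrates to zero
over the unit cube. -/
theorem setIntegral_divergence_eq_zero_of_periodic {d : ℕ}
    {G : Fin d → (Fin d → ℝ) → ℝ} (hG : ∀ i, ContDiff ℝ 1 (G i))
    (hper : ∀ i x, G i (x + Pi.single i 1) = G i x) :
    ∫ x in Set.Icc (0 : Fin d → ℝ) 1, ∑ i, pd i (G i) x = 0 := by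
  cases d with
  | zero => simp
  | succ n =>
    have hcont : Continuous fun x => ∑ i, pd i (G i) x :=
      continuous_finsetSum _ fun i _ =>
        ((hG i).continuous_fderiv one_ne_zero).clm_apply continuous_const
    refine (integral_divergence_of_hasFDerivAt_off_countable' 0 1 zero_le_one G
      (fun i => fderiv ℝ (G i)) ∅ Set.countable_empty
      (fun i => (hG i).continuous.continuousOn)
      (fun x _ i => ((hG i).differentiable one_ne_zero x).hasFDerivAt)
      (hcont.continuousOn.integrableOn_compact isCompact_Icc)).trans ?_
    refine Finset.sum_eq_zero fun i _ => ?_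
    have hface (x : Fin n → ℝ) :
        G i (i.insertNth ((1 : Fin (n + 1) → ℝ) i) x) =
          G i (i.insertNth ((0 : Fin (n + 1) → ℝ) i) x) := by
      rw [← hper i (i.insertNth ((0 : Fin (n + 1) → ℝ) i) x)]
      congr 1
      ext j
      refine Fin.succAboveCases i ?_ (fun k => ?_) j <;> simp
    simp_rw [hface, sub_self]

theorem pd_comp_add_right {d : ℕ} (i : Fin d) (f : (Fin d → ℝ) → ℝ) (a x : Fin d → ℝ) :
    pd i (fun y => f (y + a)) x = pd i f (x + a) := by
  simp only [pd, fderiv_comp_add_right]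

theorem ContDiff.pd {d : ℕ} {f : (Fin d → ℝ) → ℝ} {m n : WithTop ℕ∞} (hf : ContDiff ℝ n f)
    (hmn : m + 1 ≤ n) (i : Fin d) : ContDiff ℝ m (pd i f) :=
  (hf.fderiv_right hmn).clm_apply contDiff_const

/-- The divergence of `v ^ κ ∇v`. -/
theorem sum_pd_rpow_mul_pd {d : ℕ} {v : (Fin d → ℝ) → ℝ} (hv : ContDiff ℝ 2 v)
    (hpos : ∀ x, 0 < v x) (κ : ℝ) (x : Fin d → ℝ) :
    ∑ i, pd i (fun y => v y ^ κ * pd i v y) x =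
      v x ^ κ * (lap v x + κ * (∑ i, (pd i v x) ^ 2) / v x) := by
  have hterm (i : Fin d) : pd i (fun y => v y ^ κ * pd i v y) x =
      v x ^ κ * pd i (pd i v) x + κ * v x ^ (κ - 1) * (pd i v x) ^ 2 := by
    have hpow : HasFDerivAt (fun y => v y ^ κ) _ x :=
      ((hv.differentiable two_ne_zero) x).hasFDerivAt.rpow_const (.inl (hpos x).ne')
    have hpd : DifferentiableAt ℝ (pd i v) x :=
      (hv.pd (by norm_num [one_add_one_eq_two]) i).differentiable one_ne_zero x
    have hmul : HasFDerivAt (fun y => v y ^ κ * pd i v y) _ x := hpow.mul hpd.hasFDerivAt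
    conv_lhs => rw [pd, hmul.fderiv]
    simp only [add_apply, smul_apply, smul_eq_mul, pd]
    ring
  simp_rw [hterm, Finset.sum_add_distrib, ← Finset.mul_sum, Real.rpow_sub_one (hpos x).ne', lap]
  ring

/-- Along the flow ∂ₜu = u^{2−2β}(Δu + κ|∇u|²/u) with κ = 1+β(p−2), the quantity
∫ u^{βp} is conserved on the flat torus. -/
theorem flow_conserves_Lp (d : ℕ) (hd : 1 ≤ d) (β p : ℝ) (hβ : β ≠ 0)
    (κ : ℝ) (hκ : κ = 1 + β * (p - 2))
    (u : ℝ × (Fin d → ℝ) → ℝ) (hu : ContDiff ℝ (⊤ : ℕ∞) u)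
    (hpos : ∀ t x, 0 < u (t, x))
    (hper : ∀ (t : ℝ) (x : Fin d → ℝ) (k : Fin d → ℤ),
      u (t, x + fun i => (k i : ℝ)) = u (t, x))
    (hflow : ∀ t x, deriv (fun s => u (s, x)) t
      = u (t, x) ^ (2 - 2 * β) *
        (lap (fun y => u (t, y)) x
          + κ * (∑ i, (pd i (fun y => u (t, y)) x) ^ 2) / u (t, x))) :
    ∀ t : ℝ,
      deriv (fun s => ∫ x in Set.Icc (0 : Fin d → ℝ) 1, u (s, x) ^ (β * p)) t = 0 := by
  intro t
  have hcd : ContDiff ℝ 1 fun z => u z ^ (β * p) :=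
    (contDiff_infty.1 hu 1).rpow_const_of_ne fun z => (hpos z.1 z.2).ne'
  rw [(hasDerivAt_setIntegral_of_contDiff hcd isCompact_Icc t).deriv]
  set v : (Fin d → ℝ) → ℝ := fun y => u (t, y) with hv_def
  have hv : ContDiff ℝ 2 v :=
    (contDiff_infty.1 hu 2).comp (contDiff_prodMk_right t)
  have hvpos : ∀ x, 0 < v x := hpos t
  have hderiv (x : Fin d → ℝ) : deriv (fun s => u (s, x) ^ (β * p)) t =
      β * p * ∑ i, pd i (fun y => v y ^ κ * pd i v y) x := by
    have hdiff : DifferentiableAt ℝ (fun s => u (s, x)) t :=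
      ((hu.comp (contDiff_prodMk_left x)).differentiable (by simp)) t
    rw [(hdiff.hasDerivAt.rpow_const (.inl (hpos t x).ne')).deriv, hflow t x,
      sum_pd_rpow_mul_pd hv hvpos]
    have hexp : v x ^ κ = v x ^ (2 - 2 * β) * v x ^ (β * p - 1) := by
      rw [← Real.rpow_add (hvpos x), hκ]
      ring_nf
    rw [hexp]
    ring
  simp_rw [hderiv]
  rw [integral_const_mul, setIntegral_divergence_eq_zero_of_periodic, mul_zero]
  · exact fun i => ((hv.of_le one_le_two).rpow_const_of_ne fun x => (hvpos x).ne').mul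
      (hv.pd (by norm_num [one_add_one_eq_two]) i)
  · intro i x
    have hvper (y : Fin d → ℝ) : v (y + Pi.single i 1) = v y := by
      refine Eq.trans ?_ (hper t y (Pi.single i 1))
      simp only [hv_def]
      congr 3
      ext j
      by_cases h : j = i <;> simp [h]
    rw [hvper, ← pd_comp_add_right]
    simp_rw [hvper]
end

section
/- Let d ≥ 1 be an integer, β ≠ 0, λ real, and p real with p ≠ 2 and βp ≠ 0; set κ = 1+β(p−2). Let u : ℝ × ℝ^d → ℝ be smooth, positive, ℤ^d-periodic in x, and satisfy ∂ₜu = u^{2−2β}·(Δₓu + κ·|∇ₓu|²/u). Define F(t) = ∫_{[0,1]^d} |∇ₓ(u(t,·)^β)|² dx + (λ/(p−2))·[∫_{[0,1]^d} u(t,·)^{2β} dx − (∫_{[0,1]^d} u(t,·)^{βp} dx)^{2/p}]. Then F is differentiable and for every t, F'(t) = 2β²·( −∫_{[0,1]^d} [ (Δu)² + (κ+β−1)·Δu·|∇u|²/u + κ(β−1)·|∇u|⁴/u² ] dx + λ·∫_{[0,1]^d} |∇u|² dx ), where the integrands are evaluated at (t,x). -/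
open MeasureTheory

/-- The derivative of `g` at `z` in the direction `v`. -/
noncomputable def dirDeriv {E : Type*} [NormedAddCommGroup E] [NormedSpace ℝ E]
    (v : E) (g : E → ℝ) (z : E) : ℝ :=
  fderiv ℝ g z v

section DirDeriv

variable {E : Type*} [NormedAddCommGroup E] [NormedSpace ℝ E] {f g : E → ℝ} {z : E}

theorem ContDiff.dirDeriv (hg : ContDiff ℝ (⊤ : ℕ∞) g) (v : E) :
    ContDiff ℝ (⊤ : ℕ∞) (dirDeriv v g) :=
  (hg.fderiv_right (m := (⊤ : ℕ∞)) (by norm_cast)).clm_apply contDiff_const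

theorem ContDiff.differentiable_of_top (hg : ContDiff ℝ (⊤ : ℕ∞) g) : Differentiable ℝ g :=
  hg.differentiable (by simp)

theorem dirDeriv_comm (hg : ContDiff ℝ (⊤ : ℕ∞) g) (v w z : E) :
    dirDeriv v (dirDeriv w g) z = dirDeriv w (dirDeriv v g) z := by
  have hd : DifferentiableAt ℝ (fderiv ℝ g) z :=
    (hg.fderiv_right (m := 1) (by norm_cast)).differentiable (by simp) z
  have key : ∀ a b : E, dirDeriv a (dirDeriv b g) z = fderiv ℝ (fderiv ℝ g) z a b := by
    intro a b
    have h := hd.hasFDerivAt.clm_apply (hasFDerivAt_const b z)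
    change fderiv ℝ (fun y => fderiv ℝ g y b) z a = _
    rw [h.fderiv]
    simp
  rw [key, key]
  exact (hg.contDiffAt.isSymmSndFDerivAt (by simp; norm_cast)).eq v w

theorem dirDeriv_mul (hf : DifferentiableAt ℝ f z) (hg : DifferentiableAt ℝ g z) (v : E) :
    dirDeriv v (fun y => f y * g y) z = dirDeriv v f z * g z + f z * dirDeriv v g z := by
  simp only [dirDeriv]
  rw [(hf.hasFDerivAt.fun_mul hg.hasFDerivAt).fderiv]
  simp
  ring

theorem dirDeriv_sum_sq {ι : Type*} [Fintype ι] {h : ι → E → ℝ}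
    (hh : ∀ i, DifferentiableAt ℝ (h i) z) (v : E) :
    dirDeriv v (fun y => ∑ i, h i y ^ 2) z = 2 * ∑ i, dirDeriv v (h i) z * h i z := by
  simp only [dirDeriv]
  rw [(HasFDerivAt.fun_sum fun i _ => (hh i).hasFDerivAt.pow 2).fderiv]
  simp [Finset.mul_sum]
  exact Finset.sum_congr rfl fun i _ => by ring

theorem dirDeriv_rpow (hg : DifferentiableAt ℝ g z) (hz : 0 < g z) (r : ℝ) (v : E) :
    dirDeriv v (fun y => g y ^ r) z = r * g z ^ (r - 1) * dirDeriv v g z := by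
  simp only [dirDeriv]
  rw [(hg.hasFDerivAt.rpow_const (Or.inl hz.ne')).fderiv]
  simp

theorem dirDeriv_dirDeriv_rpow (hg : ContDiff ℝ (⊤ : ℕ∞) g) (hpos : ∀ y, 0 < g y) (r : ℝ)
    (v z : E) :
    dirDeriv v (dirDeriv v fun y => g y ^ r) z
      = r * g z ^ (r - 1) * (dirDeriv v (dirDeriv v g) z
          + (r - 1) * dirDeriv v g z ^ 2 / g z) := by
  have h1 : (dirDeriv v fun y => g y ^ r)
      = fun y => r * (g y ^ (r - 1) * dirDeriv v g y) := by
    funext y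
    rw [dirDeriv_rpow (hg.differentiable_of_top y) (hpos y), mul_assoc]
  have hd1 : DifferentiableAt ℝ (fun y => g y ^ (r - 1)) z :=
    (hg.differentiable_of_top z).rpow_const (Or.inl (hpos z).ne')
  have hd2 : DifferentiableAt ℝ (dirDeriv v g) z := (hg.dirDeriv v).differentiable_of_top z
  rw [h1, dirDeriv_mul (f := fun _ => r) (by fun_prop) (hd1.fun_mul hd2), dirDeriv_mul hd1 hd2,
    dirDeriv_rpow (hg.differentiable_of_top z) (hpos z), Real.rpow_sub_one (hpos z).ne' (r - 1)]
  have h0 : dirDeriv v (fun _ : E => r) z = 0 := by simp [dirDeriv]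
  rw [h0]
  have := (hpos z).ne'
  field_simp
  ring

end DirDeriv

section Slices

variable {d : ℕ} {g : ℝ × (Fin d → ℝ) → ℝ}

theorem pd_slice (hg : Differentiable ℝ g) (i : Fin d) (t : ℝ) :
    pd i (fun y => g (t, y)) = fun x => dirDeriv (0, Pi.single i 1) g (t, x) := by
  funext x
  have h : HasFDerivAt (fun y : Fin d → ℝ => g (t, y)) _ x :=
    (hg (t, x)).hasFDerivAt.comp x (hasFDerivAt_prodMk_right t x)
  simp only [pd, dirDeriv]
  rw [h.fderiv]
  simp

theorem lap_slice (hg : ContDiff ℝ (⊤ : ℕ∞) g) (t : ℝ) (x : Fin d → ℝ) :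
    lap (fun y => g (t, y)) x
      = ∑ i, dirDeriv (0, Pi.single i 1) (dirDeriv (0, Pi.single i 1) g) (t, x) := by
  refine Finset.sum_congr rfl fun i _ => ?_
  rw [pd_slice hg.differentiable_of_top, pd_slice (hg.dirDeriv _).differentiable_of_top]

theorem hasDerivAt_time_slice (hg : Differentiable ℝ g) (t : ℝ) (x : Fin d → ℝ) :
    HasDerivAt (fun s => g (s, x)) (dirDeriv (1, 0) g (t, x)) t := by
  have h := (hg (t, x)).hasFDerivAt.comp_hasDerivAt t
    ((hasDerivAt_id t).prodMk (hasDerivAt_const t x))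
  exact h

/-- Differentiation under the integral sign for a smooth integrand on a compact set. -/
theorem hasDerivAt_integral_of_contDiff (hg : ContDiff ℝ (⊤ : ℕ∞) g)
    {K : Set (Fin d → ℝ)} (hK : IsCompact K) (t : ℝ) :
    HasDerivAt (fun s => ∫ x in K, g (s, x)) (∫ x in K, dirDeriv (1, 0) g (t, x)) t := by
  have hc := hg.continuous
  have hc' := (hg.dirDeriv (1, 0)).continuous
  obtain ⟨C, hC⟩ := ((isCompact_closedBall t 1).prod hK).exists_bound_of_continuousOn
    hc'.continuousOn
  have hslice : ∀ (h : ℝ × (Fin d → ℝ) → ℝ) (s : ℝ), Continuous h →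
      Integrable (fun x => h (s, x)) (volume.restrict K) := fun h s hh =>
    ContinuousOn.integrableOn_compact hK (by fun_prop)
  refine (hasDerivAt_integral_of_dominated_loc_of_deriv_le (s := Metric.closedBall t 1)
    (F := fun s x => g (s, x)) (F' := fun s x => dirDeriv (1, 0) g (s, x)) (bound := fun _ => C)
    (Metric.closedBall_mem_nhds t one_pos)
    (Filter.Eventually.of_forall fun s => (hslice g s hc).aestronglyMeasurable)
    (hslice g t hc) (hslice _ t hc').aestronglyMeasurable ?_
    (integrableOn_const hK.measure_ne_top) ?_).2
  · exact (ae_restrict_mem hK.measurableSet).mono fun x hx s hs => hC (s, x) ⟨hs, hx⟩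
  · exact Filter.Eventually.of_forall fun x s _ =>
      hasDerivAt_time_slice hg.differentiable_of_top s x

end Slices

/-- Periodicity under integer translations of the second argument. -/
def SpacePeriodic {d : ℕ} (g : ℝ × (Fin d → ℝ) → ℝ) : Prop :=
  ∀ (t : ℝ) (x : Fin d → ℝ) (k : Fin d → ℤ), g (t, x + fun i => (k i : ℝ)) = g (t, x)

section Periodic

variable {d : ℕ} {a g : ℝ × (Fin d → ℝ) → ℝ}

theorem SpacePeriodic.dirDeriv (hg : SpacePeriodic g) (v : ℝ × (Fin d → ℝ)) :
    SpacePeriodic (dirDeriv v g) := by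
  intro t x k
  have h : (fun z : ℝ × (Fin d → ℝ) => g (z + (0, fun i => (k i : ℝ)))) = g := by
    funext ⟨s, y⟩
    simpa using hg s y k
  have h2 := fderiv_comp_add_right (𝕜 := ℝ) (f := g) (x := (t, x)) (0, fun i => (k i : ℝ))
  rw [h] at h2
  simp only [_root_.dirDeriv]
  rw [h2]
  simp

/-- The divergence of a smooth periodic vector field has zero integral over the unit cube. -/
theorem integral_divergence_eq_zero (hd : 1 ≤ d) {V : Fin d → ℝ × (Fin d → ℝ) → ℝ}
    (hV : ∀ i, ContDiff ℝ (⊤ : ℕ∞) (V i)) (hper : ∀ i, SpacePeriodic (V i)) (t : ℝ) :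
    ∫ x in Set.Icc (0 : Fin d → ℝ) 1, ∑ i, dirDeriv (0, Pi.single i 1) (V i) (t, x) = 0 := by
  obtain ⟨n, rfl⟩ : ∃ n, d = n + 1 := ⟨d - 1, by omega⟩
  have hdiff : ∀ i (x : Fin (n + 1) → ℝ), HasFDerivAt (fun y => V i (t, y))
      ((fderiv ℝ (V i) (t, x)).comp (ContinuousLinearMap.inr ℝ ℝ (Fin (n + 1) → ℝ))) x :=
    fun i x => ((hV i).differentiable_of_top (t, x)).hasFDerivAt.comp x
      (hasFDerivAt_prodMk_right t x)
  have hcont : ∀ i, Continuous (dirDeriv (0, Pi.single i 1) (V i)) :=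
    fun i => ((hV i).dirDeriv _).continuous
  have key := integral_divergence_of_hasFDerivAt_off_countable'
    (a := (0 : Fin (n + 1) → ℝ)) (b := 1) zero_le_one
    (fun i y => V i (t, y))
    (fun i x => (fderiv ℝ (V i) (t, x)).comp (ContinuousLinearMap.inr ℝ ℝ (Fin (n + 1) → ℝ)))
    ∅ Set.countable_empty
    (fun i x _ => (hdiff i x).continuousAt.continuousWithinAt)
    (fun x _ i => hdiff i x)
    (ContinuousOn.integrableOn_compact isCompact_Icc (Continuous.continuousOn
      (continuous_finsetSum _ fun i _ => (hcont i).comp (Continuous.prodMk_right t))))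
  refine key.trans (Finset.sum_eq_zero fun i _ => ?_)
  rw [sub_eq_zero]
  congr 1
  funext x
  have h := hper i t (Fin.insertNth i 0 x) (Pi.single i 1)
  refine Eq.trans ?_ h
  congr 2
  funext j
  refine Fin.succAboveCases i ?_ (fun j => ?_) j
  · simp
  · simp [Fin.succAbove_ne]

/-- The first Green identity for smooth periodic functions on the unit cube. -/
theorem integral_grad_mul_grad (hd : 1 ≤ d) (ha : ContDiff ℝ (⊤ : ℕ∞) a)
    (hg : ContDiff ℝ (⊤ : ℕ∞) g) (hpa : SpacePeriodic a) (hpg : SpacePeriodic g) (t : ℝ) :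
    ∫ x in Set.Icc (0 : Fin d → ℝ) 1,
        ∑ i, dirDeriv (0, Pi.single i 1) a (t, x) * dirDeriv (0, Pi.single i 1) g (t, x)
      = - ∫ x in Set.Icc (0 : Fin d → ℝ) 1, a (t, x) *
          ∑ i, dirDeriv (0, Pi.single i 1) (dirDeriv (0, Pi.single i 1) g) (t, x) := by
  have hint : ∀ h : ℝ × (Fin d → ℝ) → ℝ, Continuous h →
      IntegrableOn (fun x => h (t, x)) (Set.Icc 0 1) := fun h hh =>
    ContinuousOn.integrableOn_compact isCompact_Icc (by fun_prop)
  have hda := fun v => (ha.dirDeriv v).continuous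
  have hdg := fun v => (hg.dirDeriv v).continuous
  have hddg := fun v w => ((hg.dirDeriv v).dirDeriv w).continuous
  rw [eq_neg_iff_add_eq_zero, ← integral_add
    (hint (fun z => ∑ i, dirDeriv (0, Pi.single i 1) a z * dirDeriv (0, Pi.single i 1) g z)
      (continuous_finsetSum _ fun i _ => (hda _).mul (hdg _)))
    (hint (fun z => a z * ∑ i, dirDeriv (0, Pi.single i 1) (dirDeriv (0, Pi.single i 1) g) z)
      (ha.continuous.mul (continuous_finsetSum _ fun i _ => hddg _ _)))]
  refine Eq.trans ?_ (integral_divergence_eq_zero hd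
    (V := fun i z => a z * dirDeriv (0, Pi.single i 1) g z)
    (fun i => ha.mul (hg.dirDeriv _))
    (fun i s x k => by
      change a _ * _ = a _ * _
      rw [hpa s x k, hpg.dirDeriv _ s x k]) t)
  congr 1
  funext x
  rw [Finset.mul_sum, ← Finset.sum_add_distrib]
  refine Finset.sum_congr rfl fun i _ => ?_
  rw [dirDeriv_mul (ha.differentiable_of_top _) ((hg.dirDeriv _).differentiable_of_top _)]

end Periodic

section Flow

/-- The squared norm of the spatial gradient. -/
noncomputable def gradSq {d : ℕ} (g : ℝ × (Fin d → ℝ) → ℝ) (z : ℝ × (Fin d → ℝ)) : ℝ :=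
  ∑ i, dirDeriv (0, Pi.single i 1) g z ^ 2

/-- The spatial Laplacian. -/
noncomputable def spaceLap {d : ℕ} (g : ℝ × (Fin d → ℝ) → ℝ) (z : ℝ × (Fin d → ℝ)) : ℝ :=
  ∑ i, dirDeriv (0, Pi.single i 1) (dirDeriv (0, Pi.single i 1) g) z

variable {d : ℕ} {u : ℝ × (Fin d → ℝ) → ℝ}

theorem ContDiff.gradSq (hu : ContDiff ℝ (⊤ : ℕ∞) u) : ContDiff ℝ (⊤ : ℕ∞) (gradSq u) :=
  ContDiff.sum fun _ _ => (hu.dirDeriv _).pow 2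

theorem ContDiff.spaceLap (hu : ContDiff ℝ (⊤ : ℕ∞) u) : ContDiff ℝ (⊤ : ℕ∞) (spaceLap u) :=
  ContDiff.sum fun _ _ => (hu.dirDeriv _).dirDeriv _

theorem spaceLap_rpow (hu : ContDiff ℝ (⊤ : ℕ∞) u) (hpos : ∀ z, 0 < u z) (r : ℝ)
    (z : ℝ × (Fin d → ℝ)) :
    spaceLap (fun y => u y ^ r) z
      = r * u z ^ (r - 1) * (spaceLap u z + (r - 1) * gradSq u z / u z) := by
  simp only [spaceLap, gradSq]
  rw [Finset.mul_sum, Finset.sum_div, ← Finset.sum_add_distrib, Finset.mul_sum]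
  exact Finset.sum_congr rfl fun i _ => dirDeriv_dirDeriv_rpow hu hpos r _ z

/-- The integral over the unit cube of the divergence of `u ^ s • ∇u` vanishes. -/
theorem integral_rpow_mul_gradSq (hd : 1 ≤ d) (hu : ContDiff ℝ (⊤ : ℕ∞) u)
    (hpos : ∀ z, 0 < u z) (hper : SpacePeriodic u) (s t : ℝ) :
    ∫ x in Set.Icc (0 : Fin d → ℝ) 1, s * u (t, x) ^ (s - 1) * gradSq u (t, x)
      = - ∫ x in Set.Icc (0 : Fin d → ℝ) 1, u (t, x) ^ s * spaceLap u (t, x) := by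
  refine Eq.trans ?_ (integral_grad_mul_grad hd (a := fun z => u z ^ s)
    (hu.rpow_const_of_ne fun z => (hpos z).ne') hu
    (fun t x k => congrArg (· ^ s) (hper t x k)) hper t)
  congr 1
  funext x
  rw [gradSq, Finset.mul_sum]
  refine Finset.sum_congr rfl fun i _ => ?_
  rw [dirDeriv_rpow (hu.differentiable_of_top _) (hpos _)]
  ring

theorem integrableOn_slice {h : ℝ × (Fin d → ℝ) → ℝ} (hh : Continuous h) (t : ℝ) :
    IntegrableOn (fun x => h (t, x)) (Set.Icc 0 1) :=
  ContinuousOn.integrableOn_compact isCompact_Icc (by fun_prop)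

/-- The evolution of `∫ u ^ r` along the flow. -/
theorem hasDerivAt_integral_rpow (hd : 1 ≤ d) (hu : ContDiff ℝ (⊤ : ℕ∞) u)
    (hpos : ∀ z, 0 < u z) (hper : SpacePeriodic u) {β κ : ℝ}
    (hflow : ∀ z, dirDeriv (1, 0) u z
      = u z ^ (2 - 2 * β) * (spaceLap u z + κ * gradSq u z / u z))
    {r s : ℝ} (hs : s = r + 1 - 2 * β) (t : ℝ) :
    HasDerivAt (fun τ => ∫ x in Set.Icc (0 : Fin d → ℝ) 1, u (τ, x) ^ r)
      (r * (κ - s) * ∫ x in Set.Icc (0 : Fin d → ℝ) 1, u (t, x) ^ (s - 1) * gradSq u (t, x))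
      t := by
  have hsm : ∀ q : ℝ, ContDiff ℝ (⊤ : ℕ∞) fun z => u z ^ q :=
    fun q => hu.rpow_const_of_ne fun z => (hpos z).ne'
  convert hasDerivAt_integral_of_contDiff (hsm r) isCompact_Icc t using 1
  have h1 : ∀ x, dirDeriv (1, 0) (fun z => u z ^ r) (t, x)
      = r * (u (t, x) ^ s * spaceLap u (t, x))
        + r * κ * (u (t, x) ^ (s - 1) * gradSq u (t, x)) := by
    intro x
    have e : u (t, x) ^ s = u (t, x) ^ (r - 1) * u (t, x) ^ (2 - 2 * β) := by
      rw [← Real.rpow_add (hpos _), hs]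
      ring_nf
    rw [dirDeriv_rpow (hu.differentiable_of_top _) (hpos _), hflow,
      Real.rpow_sub_one (hpos _).ne' s, e]
    ring
  have h2 := integral_rpow_mul_gradSq hd hu hpos hper s t
  simp only [mul_assoc] at h2
  rw [integral_const_mul] at h2
  simp only [h1]
  rw [integral_add
    ((integrableOn_slice ((hsm s).mul hu.spaceLap).continuous t).const_mul r)
    ((integrableOn_slice ((hsm (s - 1)).mul hu.gradSq).continuous t).const_mul (r * κ)),
    integral_const_mul, integral_const_mul]
  linear_combination (-r) * h2

/-- The evolution of the Dirichlet energy of a smooth periodic function. -/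
theorem hasDerivAt_integral_gradSq (hd : 1 ≤ d) {w : ℝ × (Fin d → ℝ) → ℝ}
    (hw : ContDiff ℝ (⊤ : ℕ∞) w) (hper : SpacePeriodic w) (t : ℝ) :
    HasDerivAt (fun τ => ∫ x in Set.Icc (0 : Fin d → ℝ) 1, gradSq w (τ, x))
      (-2 * ∫ x in Set.Icc (0 : Fin d → ℝ) 1, dirDeriv (1, 0) w (t, x) * spaceLap w (t, x))
      t := by
  convert hasDerivAt_integral_of_contDiff hw.gradSq isCompact_Icc t using 1
  have h := integral_grad_mul_grad hd (hw.dirDeriv (1, 0)) hw (hper.dirDeriv (1, 0)) hper t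
  have h1 : ∀ x, dirDeriv (1, 0) (gradSq w) (t, x) = 2 * ∑ i,
      dirDeriv (0, Pi.single i 1) (dirDeriv (1, 0) w) (t, x)
        * dirDeriv (0, Pi.single i 1) w (t, x) := by
    intro x
    refine (dirDeriv_sum_sq (fun i => (hw.dirDeriv _).differentiable_of_top _) _).trans ?_
    simp only [dirDeriv_comm hw (1, 0)]
  simp only [h1]
  rw [integral_const_mul, h]
  simp only [spaceLap]
  ring

end Flow

/-- The derivative of the interpolation functional along the porous-medium flow
on the flat torus. -/
theorem functional_derivative_along_flow (d : ℕ) (hd : 1 ≤ d) (β lam p : ℝ)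
    (hβ : β ≠ 0) (hp : p ≠ 2) (hβp : β * p ≠ 0)
    (κ : ℝ) (hκ : κ = 1 + β * (p - 2))
    (u : ℝ × (Fin d → ℝ) → ℝ) (hu : ContDiff ℝ (⊤ : ℕ∞) u)
    (hpos : ∀ t x, 0 < u (t, x))
    (hper : ∀ (t : ℝ) (x : Fin d → ℝ) (k : Fin d → ℤ),
      u (t, x + fun i => (k i : ℝ)) = u (t, x))
    (hflow : ∀ t x, deriv (fun s => u (s, x)) t
      = u (t, x) ^ (2 - 2 * β) *
        (lap (fun y => u (t, y)) x
          + κ * (∑ i, (pd i (fun y => u (t, y)) x) ^ 2) / u (t, x)))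
    (F : ℝ → ℝ)
    (hF : F = fun t =>
      (∫ x in Set.Icc (0 : Fin d → ℝ) 1,
          ∑ i, (pd i (fun y => u (t, y) ^ β) x) ^ 2)
      + (lam / (p - 2)) *
        ((∫ x in Set.Icc (0 : Fin d → ℝ) 1, u (t, x) ^ (2 * β))
          - (∫ x in Set.Icc (0 : Fin d → ℝ) 1, u (t, x) ^ (β * p)) ^ (2 / p))) :
    ∀ t : ℝ, HasDerivAt F
      (2 * β ^ 2 *
        (- (∫ x in Set.Icc (0 : Fin d → ℝ) 1,
              ((lap (fun y => u (t, y)) x) ^ 2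
                + (κ + β - 1) * lap (fun y => u (t, y)) x
                    * (∑ i, (pd i (fun y => u (t, y)) x) ^ 2) / u (t, x)
                + κ * (β - 1) * (∑ i, (pd i (fun y => u (t, y)) x) ^ 2) ^ 2
                    / (u (t, x)) ^ 2))
          + lam * ∫ x in Set.Icc (0 : Fin d → ℝ) 1,
              ∑ i, (pd i (fun y => u (t, y)) x) ^ 2)) t := by
  intro t
  have hdu := hu.differentiable_of_top
  have hpos' : ∀ z, 0 < u z := fun z => hpos z.1 z.2
  have hw : ContDiff ℝ (⊤ : ℕ∞) fun z => u z ^ β :=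
    hu.rpow_const_of_ne fun z => (hpos' z).ne'
  have hgrad : ∀ s x, ∑ i, (pd i (fun y => u (s, y)) x) ^ 2 = gradSq u (s, x) := by
    intro s x
    simp only [pd_slice hdu, gradSq]
  have hlap : ∀ s x, lap (fun y => u (s, y)) x = spaceLap u (s, x) := lap_slice hu
  have hgradw : ∀ s x, ∑ i, (pd i (fun y => u (s, y) ^ β) x) ^ 2
      = gradSq (fun z => u z ^ β) (s, x) := by
    intro s x
    simp only [pd_slice hw.differentiable_of_top, gradSq]
  have hflow' : ∀ z, dirDeriv (1, 0) u z
      = u z ^ (2 - 2 * β) * (spaceLap u z + κ * gradSq u z / u z) := by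
    rintro ⟨s, x⟩
    rw [← (hasDerivAt_time_slice hdu s x).deriv, hflow, hgrad, hlap]
  simp only [hgradw] at hF
  simp only [hgrad, hlap]
  have hE := hasDerivAt_integral_gradSq hd hw
    (fun s x k => congrArg (· ^ β) (hper s x k)) t
  have hM := hasDerivAt_integral_rpow hd hu hpos' hper hflow' (r := 2 * β) (s := 1) (by ring) t
  have hP : ∀ s, HasDerivAt
      (fun τ => ∫ x in Set.Icc (0 : Fin d → ℝ) 1, u (τ, x) ^ (β * p)) 0 s := by
    intro s
    convert hasDerivAt_integral_rpow hd hu hpos' hper hflow' (r := β * p) (s := κ)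
      (by rw [hκ]; ring) s using 1
    ring
  have hconst : (fun τ => (∫ x in Set.Icc (0 : Fin d → ℝ) 1, u (τ, x) ^ (β * p)) ^ (2 / p))
      = fun _ => (∫ x in Set.Icc (0 : Fin d → ℝ) 1, u (t, x) ^ (β * p)) ^ (2 / p) :=
    funext fun τ => congrArg (· ^ (2 / p)) (is_const_of_deriv_eq_zero
      (fun s => (hP s).differentiableAt) (fun s => (hP s).deriv) τ t)
  have hC : HasDerivAt
      (fun τ => (∫ x in Set.Icc (0 : Fin d → ℝ) 1, u (τ, x) ^ (β * p)) ^ (2 / p)) 0 t := by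
    rw [hconst]
    exact hasDerivAt_const t _
  rw [hF]
  refine (hE.fun_add ((hM.fun_sub hC).const_mul (lam / (p - 2)))).congr_deriv ?_
  have hdissip : ∀ x, dirDeriv (1, 0) (fun z => u z ^ β) (t, x)
        * spaceLap (fun z => u z ^ β) (t, x)
      = β ^ 2 * ((spaceLap u (t, x)) ^ 2
          + (κ + β - 1) * spaceLap u (t, x) * gradSq u (t, x) / u (t, x)
          + κ * (β - 1) * (gradSq u (t, x)) ^ 2 / (u (t, x)) ^ 2) := by
    intro x
    have hx := hpos t x
    have e : u (t, x) ^ (β - 1) * u (t, x) ^ (β - 1) * u (t, x) ^ (2 - 2 * β) = 1 := by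
      rw [← Real.rpow_add hx, ← Real.rpow_add hx]
      ring_nf
      exact Real.rpow_zero _
    rw [dirDeriv_rpow (hdu _) hx, spaceLap_rpow hu hpos', hflow']
    linear_combination (β ^ 2 * (spaceLap u (t, x) + κ * gradSq u (t, x) / u (t, x))
      * (spaceLap u (t, x) + (β - 1) * gradSq u (t, x) / u (t, x))) * e
  have hp2 : p - 2 ≠ 0 := sub_ne_zero.mpr hp
  simp only [hdissip, sub_self, Real.rpow_zero, one_mul]
  have hcoef : lam / (p - 2) * (2 * β * (κ - 1)) = 2 * β ^ 2 * lam := by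
    rw [hκ]
    field_simp
    ring
  rw [integral_const_mul]
  linear_combination (∫ x in Set.Icc (0 : Fin d → ℝ) 1, gradSq u (t, x)) * hcoef
end

section
/- Let β ≠ 0, λ real, and p real with p ≠ 2; set κ = 1+β(p−2). Let u : ℝ × ℝ → ℝ be smooth, positive, 1-periodic in x, and satisfy ∂ₜu = u^{2−2β}·(∂ₓ²u + κ·(∂ₓu)²/u). Define F(t) = ∫₀¹ (∂ₓ(u(t,·)^β))² dx + (λ/(p−2))·[∫₀¹ u^{2β} dx − (∫₀¹ u^{βp} dx)^{2/p}]. Then for every t, F'(t) = 2β²·( −∫₀¹ [ (∂ₓ²u)² + μ·(∂ₓu)⁴/u² ] dx + λ·∫₀¹ (∂ₓu)² dx ), where μ = (1/3)·β(p−1) + (1+β(p−2))(β−1). -/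
open MeasureTheory intervalIntegral

/-- The directional derivative of a function on the plane in the constant direction `e`. -/
noncomputable def partialDeriv (e : ℝ × ℝ) (f : ℝ × ℝ → ℝ) (z : ℝ × ℝ) : ℝ :=
  fderiv ℝ f z e

lemma ContDiff.partialDeriv {f : ℝ × ℝ → ℝ} (hf : ContDiff ℝ (⊤ : ℕ∞) f) (e : ℝ × ℝ) :
    ContDiff ℝ (⊤ : ℕ∞) (partialDeriv e f) :=
  (hf.fderiv_right (m := (⊤ : ℕ∞)) (by simp)).clm_apply contDiff_const

lemma ContDiff.hasDerivAt_fst {f : ℝ × ℝ → ℝ} (hf : ContDiff ℝ (⊤ : ℕ∞) f) (t x : ℝ) :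
    HasDerivAt (fun s => f (s, x)) (_root_.partialDeriv (1, 0) f (t, x)) t :=
  ((hf.differentiable (by simp)) (t, x)).hasFDerivAt.comp_hasDerivAt t
    ((hasDerivAt_id t).prodMk (hasDerivAt_const t x))

lemma ContDiff.hasDerivAt_snd {f : ℝ × ℝ → ℝ} (hf : ContDiff ℝ (⊤ : ℕ∞) f) (t x : ℝ) :
    HasDerivAt (fun y => f (t, y)) (_root_.partialDeriv (0, 1) f (t, x)) x :=
  ((hf.differentiable (by simp)) (t, x)).hasFDerivAt.comp_hasDerivAt x
    ((hasDerivAt_const x t).prodMk (hasDerivAt_id x))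

lemma partialDeriv_comm {f : ℝ × ℝ → ℝ} (hf : ContDiff ℝ (⊤ : ℕ∞) f) (e e' z : ℝ × ℝ) :
    partialDeriv e (partialDeriv e' f) z = partialDeriv e' (partialDeriv e f) z := by
  have hd : DifferentiableAt ℝ (fderiv ℝ f) z :=
    (hf.fderiv_right (m := (⊤ : ℕ∞)) (by simp)).differentiable (by simp) z
  have key (v w : ℝ × ℝ) :
      partialDeriv v (partialDeriv w f) z = fderiv ℝ (fderiv ℝ f) z v w := by
    change fderiv ℝ (fun y => fderiv ℝ f y w) z v = _
    rw [fderiv_clm_apply hd (differentiableAt_const w)]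
    simp
  rw [key, key]
  exact hf.contDiffAt.isSymmSndFDerivAt (by
    rw [minSmoothness_of_isRCLikeNormedField]
    exact WithTop.coe_le_coe.2 (le_top : (2 : ℕ∞) ≤ ⊤)) e e'

lemma partialDeriv_periodic {f : ℝ × ℝ → ℝ} {a : ℝ × ℝ} (hper : ∀ z, f (z + a) = f z)
    (e z : ℝ × ℝ) : partialDeriv e f (z + a) = partialDeriv e f z := by
  have h := fderiv_comp_add_right (𝕜 := ℝ) (f := f) (x := z) a
  rw [funext hper] at h
  exact congrArg (fun L : ℝ × ℝ →L[ℝ] ℝ => L e) h.symm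

/-- Differentiation under the integral sign for smooth functions on the plane. -/
lemma hasDerivAt_integral_of_contDiff_s16 {f : ℝ × ℝ → ℝ} (hf : ContDiff ℝ (⊤ : ℕ∞) f)
    (a b t : ℝ) :
    HasDerivAt (fun s => ∫ x in a..b, f (s, x))
      (∫ x in a..b, partialDeriv (1, 0) f (t, x)) t := by
  have hcont (s : ℝ) : Continuous fun x => f (s, x) := hf.continuous.comp (by fun_prop)
  have hcont' : Continuous (partialDeriv (1, 0) f) := (hf.partialDeriv _).continuous
  obtain ⟨C, hC⟩ := ((isCompact_closedBall t 1).prod (isCompact_uIcc (a := a) (b := b))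
    ).exists_bound_of_continuousOn hcont'.continuousOn
  refine (intervalIntegral.hasDerivAt_integral_of_dominated_loc_of_deriv_le
    (bound := fun _ => C) (F' := fun s x => partialDeriv (1, 0) f (s, x))
    (Metric.closedBall_mem_nhds t one_pos)
    (.of_forall fun s => (hcont s).aestronglyMeasurable)
    ((hcont t).intervalIntegrable a b)
    (hcont'.comp (by fun_prop : Continuous fun x : ℝ => (t, x))).aestronglyMeasurable
    (.of_forall fun x hx s hs => hC (s, x) ⟨hs, Set.uIoc_subset_uIcc hx⟩)
    intervalIntegrable_const
    (.of_forall fun x _ s _ => hf.hasDerivAt_fst s x)).2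

/-- If the time derivative of a density `f` is `h` plus the derivative of a flux `g` taking equal
values at both endpoints, then the integral of `f` has derivative the integral of `h`. -/
lemma hasDerivAt_integral_of_flux {f : ℝ × ℝ → ℝ} (hf : ContDiff ℝ (⊤ : ℕ∞) f) {a b t : ℝ}
    {g f' g' h : ℝ → ℝ} (hg : ContDiff ℝ (⊤ : ℕ∞) g) (hgab : g b = g a)
    (hf' : ∀ x, HasDerivAt (fun s => f (s, x)) (f' x) t)
    (hg' : ∀ x, HasDerivAt g (g' x) x) (hflux : ∀ x, f' x = h x + g' x) :
    HasDerivAt (fun s => ∫ x in a..b, f (s, x)) (∫ x in a..b, h x) t := by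
  have hf'_eq : f' = fun x => partialDeriv (1, 0) f (t, x) :=
    funext fun x => (hf' x).unique (hf.hasDerivAt_fst t x)
  have hg'_eq : g' = deriv g := funext fun x => (hg' x).deriv.symm
  have hf'_cont : Continuous f' := by
    rw [hf'_eq]
    exact (hf.partialDeriv _).continuous.comp (by fun_prop)
  have hg'_cont : Continuous g' := by
    rw [hg'_eq]
    exact hg.continuous_deriv (by simp)
  have hh : h = fun x => f' x - g' x := funext fun x => by rw [hflux]; ring
  have hzero : ∫ x in a..b, g' x = 0 := by
    rw [intervalIntegral.integral_eq_sub_of_hasDerivAt (fun x _ => hg' x)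
      (hg'_cont.intervalIntegrable a b), hgab, sub_self]
  rw [hh, intervalIntegral.integral_sub (hf'_cont.intervalIntegrable a b)
    (hg'_cont.intervalIntegrable a b), hzero, sub_zero, hf'_eq]
  exact hasDerivAt_integral_of_contDiff_s16 hf a b t

/-- One-dimensional flow computation: along ∂ₜu = u^{2−2β}(u'' + κ(u')²/u) with
κ = 1+β(p−2), the interpolation functional F satisfies
F'(t) = 2β²(−∫₀¹[(u'')² + μ(u')⁴/u²] + λ∫₀¹(u')²), with
μ = (1/3)β(p−1) + (1+β(p−2))(β−1). -/
theorem flow_derivative_1d (β lam p : ℝ) (hβ : β ≠ 0) (hp : p ≠ 2)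
    (κ : ℝ) (hκ : κ = 1 + β * (p - 2))
    (u : ℝ × ℝ → ℝ) (hu : ContDiff ℝ (⊤ : ℕ∞) u)
    (hpos : ∀ t x, 0 < u (t, x))
    (hper : ∀ t x : ℝ, u (t, x + 1) = u (t, x))
    (hflow : ∀ t x, deriv (fun s => u (s, x)) t
      = u (t, x) ^ (2 - 2 * β) *
        (deriv (deriv (fun y => u (t, y))) x
          + κ * (deriv (fun y => u (t, y)) x) ^ 2 / u (t, x)))
    (F : ℝ → ℝ)
    (hF : F = fun t =>
      (∫ x in (0:ℝ)..1, (deriv (fun y => u (t, y) ^ β) x) ^ 2)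
      + (lam / (p - 2)) *
        ((∫ x in (0:ℝ)..1, u (t, x) ^ (2 * β))
          - (∫ x in (0:ℝ)..1, u (t, x) ^ (β * p)) ^ (2 / p))) :
    ∀ t : ℝ, HasDerivAt F
      (2 * β ^ 2 *
        (- (∫ x in (0:ℝ)..1,
              ((deriv (deriv (fun y => u (t, y))) x) ^ 2
                + ((1 / 3) * β * (p - 1) + (1 + β * (p - 2)) * (β - 1)) *
                    (deriv (fun y => u (t, y)) x) ^ 4 / (u (t, x)) ^ 2))
          + lam * ∫ x in (0:ℝ)..1, (deriv (fun y => u (t, y)) x) ^ 2)) t := by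
  intro t
  set ut := partialDeriv (1, 0) u
  set ux := partialDeriv (0, 1) u
  set uxx := partialDeriv (0, 1) ux
  have hu_x : ContDiff ℝ (⊤ : ℕ∞) ux := hu.partialDeriv _
  have hderiv (s x : ℝ) : deriv (fun y => u (s, y)) x = ux (s, x) := (hu.hasDerivAt_snd s x).deriv
  have hderiv2 (s x : ℝ) : deriv (fun y => ux (s, y)) x = uxx (s, x) :=
    (hu_x.hasDerivAt_snd s x).deriv
  have hne (z : ℝ × ℝ) : u z ≠ 0 := (hpos z.1 z.2).ne'
  have hrpow (q : ℝ) : ContDiff ℝ (⊤ : ℕ∞) fun z => u z ^ q := hu.rpow_const_of_ne hne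
  have hpert (z : ℝ × ℝ) : u (z + (0, 1)) = u z := by
    simpa [Prod.add_def] using hper z.1 z.2
  have hends : u (t, 1) = u (t, 0) := by simpa using hper t 0
  have hends_x : ux (t, 1) = ux (t, 0) := by simpa using partialDeriv_periodic hpert (0, 1) (t, 0)
  have hslice : ContDiff ℝ (⊤ : ℕ∞) fun x : ℝ => (t, x) := contDiff_const.prodMk contDiff_id
  have hflow' (x : ℝ) : ut (t, x) = u (t, x) ^ (2 - 2 * β) *
      (uxx (t, x) + κ * ux (t, x) ^ 2 / u (t, x)) := by
    have h := hflow t x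
    rwa [(hu.hasDerivAt_fst t x).deriv, funext (hderiv t), hderiv2] at h
  have hrpow_t (q x : ℝ) :
      HasDerivAt (fun s => u (s, x) ^ q) (ut (t, x) * q * u (t, x) ^ (q - 1)) t :=
    (hu.hasDerivAt_fst t x).rpow_const (.inl (hne _))
  have hrpow_x (q s x : ℝ) :
      HasDerivAt (fun y => u (s, y) ^ q) (ux (s, x) * q * u (s, x) ^ (q - 1)) x :=
    (hu.hasDerivAt_snd s x).rpow_const (.inl (hne _))
  set μ : ℝ := (1 / 3) * β * (p - 1) + (1 + β * (p - 2)) * (β - 1) with hμ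
  simp only [funext (hderiv t), hderiv2]
  have hmass : HasDerivAt (fun s => ∫ x in (0:ℝ)..1, u (s, x) ^ (β * p)) 0 t := by
    have h := hasDerivAt_integral_of_flux (a := 0) (b := 1) (t := t) (hrpow (β * p))
      (g := fun x => β * p * (u (t, x) ^ κ * ux (t, x))) (h := fun _ => 0)
      (contDiff_const.mul (((hrpow κ).mul hu_x).comp hslice)) (by simp only [hends, hends_x])
      (fun x => hrpow_t (β * p) x)
      (fun x => ((hrpow_x κ t x).mul (hu_x.hasDerivAt_snd t x)).const_mul (β * p)) (fun x => by
        have h0 := hpos t x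
        have e1 : u (t, x) ^ (β * p - 1) * u (t, x) ^ (2 - 2 * β) = u (t, x) ^ κ := by
          rw [← Real.rpow_add h0, hκ]; ring_nf
        rw [hflow', Real.rpow_sub_one h0.ne' κ, ← e1]
        field_simp
        ring)
    simpa using h
  have hmass_pos : 0 < ∫ x in (0:ℝ)..1, u (t, x) ^ (β * p) :=
    intervalIntegral.intervalIntegral_pos_of_pos
      (((hrpow (β * p)).continuous.comp hslice.continuous).intervalIntegrable 0 1)
      (fun x => Real.rpow_pos_of_pos (hpos t x) _) one_pos
  have hsq : HasDerivAt (fun s => ∫ x in (0:ℝ)..1, u (s, x) ^ (2 * β))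
      (∫ x in (0:ℝ)..1, 2 * β ^ 2 * (p - 2) * ux (t, x) ^ 2) t :=
    hasDerivAt_integral_of_flux (hrpow (2 * β))
      (g := fun x => 2 * β * (u (t, x) * ux (t, x)))
      (contDiff_const.mul ((hu.mul hu_x).comp hslice)) (by simp only [hends, hends_x])
      (fun x => hrpow_t (2 * β) x)
      (fun x => ((hu.hasDerivAt_snd t x).mul (hu_x.hasDerivAt_snd t x)).const_mul (2 * β))
      (fun x => by
        have h0 := hpos t x
        have e1 : u (t, x) ^ (2 * β - 1) * u (t, x) ^ (2 - 2 * β) = u (t, x) := by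
          rw [← Real.rpow_add h0]; ring_nf; exact Real.rpow_one _
        rw [hflow', hκ]
        linear_combination (2 * β * (uxx (t, x) + (1 + β * (p - 2)) * ux (t, x) ^ 2 / u (t, x)))
          * e1 + 2 * β * (1 + β * (p - 2)) * ux (t, x) ^ 2 * mul_inv_cancel₀ h0.ne')
  have hdirichlet : HasDerivAt
      (fun s => ∫ x in (0:ℝ)..1, (deriv (fun y => u (s, y) ^ β) x) ^ 2)
      (∫ x in (0:ℝ)..1, -2 * β ^ 2 * (uxx (t, x) ^ 2 + μ * ux (t, x) ^ 4 / u (t, x) ^ 2)) t := by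
    set v : ℝ × ℝ → ℝ := fun z => u z ^ β
    have hv : ContDiff ℝ (⊤ : ℕ∞) v := hrpow β
    set vt := partialDeriv (1, 0) v
    set vx := partialDeriv (0, 1) v
    set vxx := partialDeriv (0, 1) vx
    have hv_t : ContDiff ℝ (⊤ : ℕ∞) vt := hv.partialDeriv _
    have hv_x : ContDiff ℝ (⊤ : ℕ∞) vx := hv.partialDeriv _
    have hvper (z : ℝ × ℝ) : v (z + (0, 1)) = v z := by simp only [v, hpert]
    have hvends_t : vt (t, 1) = vt (t, 0) := by
      simpa using partialDeriv_periodic hvper (1, 0) (t, 0)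
    have hvends_x : vx (t, 1) = vx (t, 0) := by
      simpa using partialDeriv_periodic hvper (0, 1) (t, 0)
    have hvt (x : ℝ) : vt (t, x) = ut (t, x) * β * u (t, x) ^ (β - 1) :=
      (hv.hasDerivAt_fst t x).unique (hrpow_t β x)
    have hvx (s x : ℝ) : vx (s, x) = ux (s, x) * β * u (s, x) ^ (β - 1) :=
      (hv.hasDerivAt_snd s x).unique (hrpow_x β s x)
    have hvxx (x : ℝ) : vxx (t, x) = uxx (t, x) * β * u (t, x) ^ (β - 1)
        + ux (t, x) * β * (ux (t, x) * (β - 1) * u (t, x) ^ (β - 1 - 1)) := by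
      have h := hv_x.hasDerivAt_snd t x
      rw [funext (hvx t)] at h
      exact h.unique (((hu_x.hasDerivAt_snd t x).mul_const β).mul (hrpow_x (β - 1) t x))
    have hderivv (s x : ℝ) : deriv (fun y => u (s, y) ^ β) x = vx (s, x) :=
      (hv.hasDerivAt_snd s x).deriv
    simp only [hderivv]
    refine hasDerivAt_integral_of_flux (f := fun z => vx z ^ 2) (hv_x.pow 2)
      (g := fun x => 2 * (vx (t, x) * vt (t, x))
        - 2 * β ^ 2 * (β * (p - 1) / 3) * (ux (t, x) ^ 3 / u (t, x)))
      ((contDiff_const.mul ((hv_x.mul hv_t).comp hslice)).sub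
        (contDiff_const.mul (((hu_x.pow 3).div hu hne).comp hslice)))
      (by simp only [hends, hends_x, hvends_t, hvends_x])
      (fun x => (hv_x.hasDerivAt_fst t x).pow 2)
      (fun x => (((hv_x.hasDerivAt_snd t x).mul (hv_t.hasDerivAt_snd t x)).const_mul 2).sub
        ((((hu_x.hasDerivAt_snd t x).pow 3).div (hu.hasDerivAt_snd t x) (hne _)).const_mul
          (2 * β ^ 2 * (β * (p - 1) / 3))))
      (fun x => ?_)
    have h0 := hpos t x
    have hcomm : partialDeriv (1, 0) vx (t, x) = partialDeriv (0, 1) vt (t, x) :=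
      partialDeriv_comm hv _ _ _
    have hprod : vxx (t, x) * vt (t, x) = β ^ 2 *
        (uxx (t, x) + (β - 1) * ux (t, x) ^ 2 / u (t, x)) *
        (uxx (t, x) + κ * ux (t, x) ^ 2 / u (t, x)) := by
      have e1 : u (t, x) ^ (β - 1) * u (t, x) ^ (β - 1) * u (t, x) ^ (2 - 2 * β) = 1 := by
        rw [← Real.rpow_add h0, ← Real.rpow_add h0]; ring_nf; exact Real.rpow_zero _
      rw [hvxx, hvt, hflow', Real.rpow_sub_one h0.ne' (β - 1)]
      linear_combination (β ^ 2 * (uxx (t, x) + (β - 1) * ux (t, x) ^ 2 / u (t, x)) *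
        (uxx (t, x) + κ * ux (t, x) ^ 2 / u (t, x))) * e1
    have hμ_flux : -(2 * ((β ^ 2 *
        (uxx (t, x) + (β - 1) * ux (t, x) ^ 2 / u (t, x)) *
        (uxx (t, x) + κ * ux (t, x) ^ 2 / u (t, x))))) =
        -2 * β ^ 2 * (uxx (t, x) ^ 2 + μ * ux (t, x) ^ 4 / u (t, x) ^ 2)
        - 2 * β ^ 2 * (β * (p - 1) / 3) *
          ((3 * ux (t, x) ^ 2 * uxx (t, x) * u (t, x) - ux (t, x) ^ 3 * ux (t, x))
            / u (t, x) ^ 2) := by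
      rw [hμ, hκ]
      field_simp
      ring
    rw [hcomm]
    simp only [Pi.pow_apply]
    push_cast
    linear_combination hμ_flux - 2 * hprod
  rw [hF]
  refine (hdirichlet.add ((hsq.sub (hmass.rpow_const (p := 2 / p)
    (.inl hmass_pos.ne'))).const_mul (lam / (p - 2)))).congr_deriv ?_
  rw [intervalIntegral.integral_const_mul, intervalIntegral.integral_const_mul]
  have hp2 : p - 2 ≠ 0 := sub_ne_zero.mpr hp
  field_simp
  ring
end

section
/- Let p be a real number with p ∈ (1,2) ∪ (2,∞). Then every continuously differentiable 1-periodic function v : ℝ → ℝ satisfies ∫₀¹ v'(x)² dx ≥ (4π²/(p−2))·[ (∫₀¹ |v(x)|^p dx)^{2/p} − ∫₀¹ v(x)² dx ]. -/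
open Real
open MeasureTheory Filter Topology

/-- **Wirtinger's inequality** on the circle of circumference `1`. -/
theorem wirtinger_unit_interval {f f' : ℝ → ℝ} (hf : ∀ x, HasDerivAt f (f' x) x)
    (hf' : Continuous f') (hend : f 0 = f 1) (hmean : ∫ x in (0:ℝ)..1, f x = 0) :
    4 * π ^ 2 * ∫ x in (0:ℝ)..1, f x ^ 2 ≤ ∫ x in (0:ℝ)..1, f' x ^ 2 := by
  have hfc : Continuous f := continuous_iff_continuousAt.2 fun x => (hf x).continuousAt
  have memLp : ∀ g : ℝ → ℝ, Continuous g →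
      MemLp (fun x => (g x : ℂ)) 2 (volume.restrict (Set.Ioc (0:ℝ) 1)) := by
    intro g hg
    have : MemLp (fun x => (g x : ℂ)) 2 (volume.restrict (Set.Icc (0:ℝ) 1)) := by
      obtain ⟨C, hC⟩ := isCompact_Icc.exists_bound_of_continuousOn
        (f := fun x => (g x : ℂ)) (s := Set.Icc (0:ℝ) 1) (by fun_prop)
      refine MemLp.of_bound (by fun_prop) C ?_
      filter_upwards [ae_restrict_mem measurableSet_Icc] with x hx using hC x hx
    exact this.mono_measure (Measure.restrict_mono Set.Ioc_subset_Icc_self le_rfl)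
  have h₁ := (hasSum_sq_fourierCoeffOn zero_lt_one (memLp f hfc)).mul_left (4 * π ^ 2)
  have h₂ := hasSum_sq_fourierCoeffOn zero_lt_one (memLp f' hf')
  have h₃ := hasSum_le (fun k => ?_) h₁ h₂
  · simpa using h₃
  · rcases eq_or_ne k 0 with rfl | hk
    · have : fourierCoeffOn zero_lt_one (fun x => (f x : ℂ)) 0 = 0 := by
        rw [fourierCoeffOn_eq_integral]
        simp [intervalIntegral.integral_ofReal, hmean]
      rw [this]
      simp
    · have := fourierCoeffOn_of_hasDerivAt zero_lt_one hk
        (fun x _ => (hf x).ofReal_comp)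
        ((by fun_prop : Continuous fun x => (f' x : ℂ)).intervalIntegrable 0 1)
      rw [this, hend]
      have hk' : (k : ℝ) ≠ 0 := by exact_mod_cast hk
      simp only [sub_self, mul_zero, zero_sub, Complex.ofReal_one, Complex.ofReal_zero, sub_zero,
        one_mul, norm_mul, norm_neg, norm_div, norm_one, Complex.norm_I,
        Complex.norm_real, Complex.norm_intCast, RCLike.norm_ofNat, Real.norm_eq_abs,
        mul_one]
      have hk1 : (1 : ℝ) ≤ (k : ℝ) ^ 2 := by
        rw [one_le_sq_iff_one_le_abs]
        exact_mod_cast Int.one_le_abs hk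
      rw [mul_pow, div_pow, mul_pow, mul_pow, sq_abs, sq_abs]
      have hk0 : (k : ℝ) ^ 2 ≠ 0 := pow_ne_zero 2 hk'
      field_simp
      rw [div_le_iff₀ (by positivity)]
      nlinarith [sq_nonneg ‖fourierCoeffOn zero_lt_one (fun x => (f' x : ℂ)) k‖]

/-- The energy `∫ v_x² + 4π²/(p-2) ∫ v²` is dissipated by the flow
`v_t = v_xx + (p-1) v_x²/v`. -/
theorem dissipation_nonpos {p L : ℝ} (hp : 1 ≤ p) (hL : L * (p - 2) = 4 * π ^ 2)
    {v v₁ v₂ w w₁ : ℝ → ℝ} (hv : ∀ x, 0 < v x)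
    (hd₀ : ∀ x, HasDerivAt v (v₁ x) x) (hd₁ : ∀ x, HasDerivAt v₁ (v₂ x) x)
    (hdw : ∀ x, HasDerivAt w (w₁ x) x) (hc₂ : Continuous v₂) (hcw : Continuous w₁)
    (hw : ∀ x, w x = v₂ x + (p - 1) * v₁ x ^ 2 / v x)
    (e₀ : v 0 = v 1) (e₁ : v₁ 0 = v₁ 1) (ew : w 0 = w 1) :
    ∫ x in (0:ℝ)..1, (2 * v₁ x * w₁ x + L * (2 * v x * w x)) ≤ 0 := by
  have c₀ : Continuous v := continuous_iff_continuousAt.2 fun x => (hd₀ x).continuousAt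
  have c₁ : Continuous v₁ := continuous_iff_continuousAt.2 fun x => (hd₁ x).continuousAt
  have cw : Continuous w := continuous_iff_continuousAt.2 fun x => (hdw x).continuousAt
  have hmean : ∫ x in (0:ℝ)..1, v₁ x = 0 := by
    rw [intervalIntegral.integral_eq_sub_of_hasDerivAt (fun x _ => hd₀ x)
      (c₁.intervalIntegrable 0 1), e₀, sub_self]
  have hW := wirtinger_unit_interval hd₁ hc₂ e₁ hmean
  let K' : ℝ → ℝ := fun x => 2 * (v₁ x * w₁ x + v₂ x * w x) + 2 * L * (v₁ x ^ 2 + v x * v₂ x)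
    - 2 * (p - 1) / 3 * (3 * v₁ x ^ 2 * v₂ x / v x - v₁ x ^ 4 / v x ^ 2)
  have hK : ∀ x, HasDerivAt (fun x => 2 * (v₁ x * w x) + 2 * L * (v x * v₁ x)
      - 2 * (p - 1) / 3 * (v₁ x ^ 3 / v x)) (K' x) x := by
    intro x
    have hx := (hv x).ne'
    convert! ((((hd₁ x).mul (hdw x)).const_mul 2).add
      (((hd₀ x).mul (hd₁ x)).const_mul (2 * L))).sub
      ((((hd₁ x).fun_pow 3).div (hd₀ x) hx).const_mul (2 * (p - 1) / 3)) using 1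
    simp only [K']
    push_cast
    field_simp
    ring
  have cK : Continuous K' := by
    have h := fun x => (hv x).ne'
    have h2 := fun x => pow_ne_zero 2 (h x)
    simp only [K']
    fun_prop (disch := assumption)
  have hKint : ∫ x in (0:ℝ)..1, K' x = 0 := by
    rw [intervalIntegral.integral_eq_sub_of_hasDerivAt (fun x _ => hK x)
      (cK.intervalIntegrable 0 1), e₀, e₁, ew, sub_self]
  have hle : ∫ x in (0:ℝ)..1, (2 * v₁ x * w₁ x + L * (2 * v x * w x)) ≤
      ∫ x in (0:ℝ)..1, (K' x - 2 * v₂ x ^ 2 + 2 * (4 * π ^ 2) * v₁ x ^ 2) := by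
    refine intervalIntegral.integral_mono_on zero_le_one
      ((by fun_prop : Continuous _).intervalIntegrable _ _)
      ((by fun_prop : Continuous _).intervalIntegrable _ _) fun x _ => ?_
    have hx := hv x
    have h0 : 0 ≤ 2 * (p - 1) / 3 * (v₁ x ^ 4 / v x ^ 2) := by
      have : 0 ≤ p - 1 := by linarith
      positivity
    have : K' x - 2 * v₂ x ^ 2 + 2 * (4 * π ^ 2) * v₁ x ^ 2
        - (2 * v₁ x * w₁ x + L * (2 * v x * w x)) = 2 * (p - 1) / 3 * (v₁ x ^ 4 / v x ^ 2) := by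
      simp only [K', hw, ← hL]
      field_simp
      ring
    linarith
  have hsplit : ∫ x in (0:ℝ)..1, (K' x - 2 * v₂ x ^ 2 + 2 * (4 * π ^ 2) * v₁ x ^ 2) =
      0 - 2 * (∫ x in (0:ℝ)..1, v₂ x ^ 2) + 2 * (4 * π ^ 2) * ∫ x in (0:ℝ)..1, v₁ x ^ 2 := by
    rw [intervalIntegral.integral_add, intervalIntegral.integral_sub, hKint,
      intervalIntegral.integral_const_mul, intervalIntegral.integral_const_mul]
    all_goals exact (by fun_prop : Continuous _).intervalIntegrable _ _
  linarith

/-- Convergence of integrals of a continuous function of a positive and a real argument. -/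
theorem tendsto_integral_comp_of_bounded {ι : Type*} {l : Filter ι} [l.IsCountablyGenerated]
    {Φ : ℝ → ℝ → ℝ} (hΦ : ContinuousOn (Function.uncurry Φ) (Set.Ioi 0 ×ˢ Set.univ))
    {f g : ι → ℝ → ℝ} {f₀ g₀ : ℝ → ℝ} {m M : ℝ} (hm : 0 < m)
    (hf : ∀ i, Continuous (f i)) (hg : ∀ i, Continuous (g i))
    (hfm : ∀ᶠ i in l, ∀ x, m ≤ f i x) (hfM : ∀ᶠ i in l, ∀ x ∈ Set.Icc (0:ℝ) 1, f i x ≤ M)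
    (hgM : ∀ᶠ i in l, ∀ x ∈ Set.Icc (0:ℝ) 1, |g i x| ≤ M)
    (hf₀ : ∀ x ∈ Set.Icc (0:ℝ) 1, Tendsto (fun i => f i x) l (𝓝 (f₀ x)))
    (hg₀ : ∀ x ∈ Set.Icc (0:ℝ) 1, Tendsto (fun i => g i x) l (𝓝 (g₀ x)))
    (hpos : ∀ x ∈ Set.Icc (0:ℝ) 1, 0 < f₀ x) :
    Tendsto (fun i => ∫ x in (0:ℝ)..1, Φ (f i x) (g i x)) l
      (𝓝 (∫ x in (0:ℝ)..1, Φ (f₀ x) (g₀ x))) := by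
  obtain ⟨C, hC⟩ := (isCompact_Icc.prod isCompact_Icc).exists_bound_of_continuousOn
    (f := Function.uncurry Φ) (s := Set.Icc m M ×ˢ Set.Icc (-M) M)
    (hΦ.mono (Set.prod_mono (fun x hx => hm.trans_le hx.1) (Set.subset_univ _)))
  have hsub : Set.uIoc (0:ℝ) 1 ⊆ Set.Icc 0 1 := by
    rw [Set.uIoc_of_le zero_le_one]
    exact Set.Ioc_subset_Icc_self
  refine intervalIntegral.tendsto_integral_filter_of_dominated_convergence (fun _ => C) ?_ ?_
    intervalIntegrable_const ?_
  · filter_upwards [hfm] with i hi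
    have : Continuous fun x => Function.uncurry Φ (f i x, g i x) :=
      hΦ.comp_continuous ((hf i).prodMk (hg i)) fun x => ⟨hm.trans_le (hi x), trivial⟩
    exact this.aestronglyMeasurable
  · filter_upwards [hfm, hfM, hgM] with i h1 h2 h3
    refine ae_of_all _ fun x hx => hC (f i x, g i x) ⟨⟨h1 x, h2 x (hsub hx)⟩, ?_⟩
    exact abs_le.1 (h3 x (hsub hx))
  · refine ae_of_all _ fun x hx => ?_
    have hat : ContinuousAt (Function.uncurry Φ) (f₀ x, g₀ x) :=
      hΦ.continuousAt ((isOpen_Ioi.prod isOpen_univ).mem_nhds ⟨hpos x (hsub hx), trivial⟩)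
    exact hat.tendsto.comp ((hf₀ x (hsub hx)).prodMk_nhds (hg₀ x (hsub hx)))

/-- The heat flow of the real part of a trigonometric polynomial of period `1`. -/
noncomputable def heatTrig (s : Finset ℤ) (c : ℤ → ℂ) (t x : ℝ) : ℝ :=
  ∑ k ∈ s, (c k * Complex.exp (-(2 * π * k) ^ 2 * t + 2 * π * k * x * Complex.I)).re

/-- Multiplication of Fourier coefficients by `2πik`. -/
noncomputable def coeffDeriv (c : ℤ → ℂ) (k : ℤ) : ℂ := 2 * π * k * Complex.I * c k

namespace heatTrig

variable (s : Finset ℤ) (c : ℤ → ℂ)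

theorem hasDerivAt_space (t x : ℝ) :
    HasDerivAt (heatTrig s c t) (heatTrig s (coeffDeriv c) t x) x := by
  refine HasDerivAt.fun_sum fun k _ => ?_
  refine (HasDerivAt.real_of_complex (e := fun z : ℂ =>
    c k * Complex.exp (-(2 * π * k) ^ 2 * t + 2 * π * k * z * Complex.I)) ?_)
  convert! (((((hasDerivAt_id (x : ℂ)).const_mul (2 * π * k : ℂ)).mul_const
    Complex.I).const_add (-(2 * π * k : ℂ) ^ 2 * t)).cexp).const_mul (c k) using 1
  simp only [coeffDeriv, id]
  ring

theorem hasDerivAt_time (t x : ℝ) :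
    HasDerivAt (fun t => heatTrig s c t x) (heatTrig s (coeffDeriv (coeffDeriv c)) t x) t := by
  refine HasDerivAt.fun_sum fun k _ => ?_
  refine (HasDerivAt.real_of_complex (e := fun z : ℂ =>
    c k * Complex.exp (-(2 * π * k) ^ 2 * z + 2 * π * k * x * Complex.I)) ?_)
  convert! ((((hasDerivAt_id (t : ℂ)).const_mul (-(2 * π * k : ℂ) ^ 2)).add_const
    (2 * π * k * x * Complex.I)).cexp).const_mul (c k) using 1
  simp only [coeffDeriv, id]
  ring_nf
  simp only [Complex.I_sq]
  ring

theorem continuous_uncurry : Continuous fun q : ℝ × ℝ => heatTrig s c q.1 q.2 := by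
  unfold heatTrig
  fun_prop

theorem continuous_space (t : ℝ) : Continuous (heatTrig s c t) := by
  unfold heatTrig
  fun_prop

theorem periodic (t : ℝ) : Function.Periodic (heatTrig s c t) 1 := by
  intro x
  unfold heatTrig
  refine Finset.sum_congr rfl fun k _ => ?_
  rw [show (-(2 * π * k : ℂ) ^ 2 * t + 2 * π * k * ((x + 1 : ℝ) : ℂ) * Complex.I) =
    (-(2 * π * k : ℂ) ^ 2 * t + 2 * π * k * x * Complex.I) + k * (2 * π * Complex.I) by
      push_cast; ring, Complex.exp_add, Complex.exp_int_mul_two_pi_mul_I, mul_one]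

theorem abs_le {t : ℝ} (ht : 0 ≤ t) (x : ℝ) : |heatTrig s c t x| ≤ ∑ k ∈ s, ‖c k‖ := by
  refine (Finset.abs_sum_le_sum_abs _ _).trans (Finset.sum_le_sum fun k _ => ?_)
  refine (Complex.abs_re_le_norm _).trans ?_
  rw [norm_mul, Complex.norm_exp]
  refine mul_le_of_le_one_right (norm_nonneg _) (Real.exp_le_one_iff.2 ?_)
  have : (-(2 * π * k : ℂ) ^ 2 * t + 2 * π * k * x * Complex.I).re = -((2 * π * k) ^ 2 * t) := by
    have : (-(2 * π * k : ℂ) ^ 2 * t + 2 * π * k * x * Complex.I) =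
      ((-((2 * π * k) ^ 2 * t) : ℝ) : ℂ) + ((2 * π * k * x : ℝ) : ℂ) * Complex.I := by
      push_cast; ring
    rw [this]
    simp [-Complex.ofReal_mul, -Complex.ofReal_neg]
  rw [this]
  have : 0 ≤ (2 * π * k) ^ 2 * t := by positivity
  linarith

/-- The heat flow at time `t` is the average against a Gaussian of variance `2t`. -/
theorem eq_integral_gaussian {t : ℝ} (ht : 0 ≤ t) (x : ℝ) :
    heatTrig s c t x =
      ∫ y, heatTrig s c 0 (x + y) ∂(ProbabilityTheory.gaussianReal 0 (2 * t).toNNReal) := by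
  have hint : ∀ k, Integrable (fun y : ℝ => c k * Complex.exp (-(2 * π * k) ^ 2 * (0 : ℝ) +
      2 * π * k * ((x + y : ℝ) : ℂ) * Complex.I))
      (ProbabilityTheory.gaussianReal 0 (2 * t).toNNReal) := by
    intro k
    refine Integrable.of_bound (by fun_prop) ‖c k‖ (ae_of_all _ fun y => ?_)
    rw [norm_mul, show (-(2 * π * k : ℂ) ^ 2 * (0 : ℝ) +
        2 * π * k * ((x + y : ℝ) : ℂ) * Complex.I) =
      ((2 * π * k * (x + y) : ℝ) : ℂ) * Complex.I by push_cast; ring,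
      Complex.norm_exp_ofReal_mul_I, mul_one]
  unfold heatTrig
  refine Eq.trans ?_ (integral_finsetSum s fun k _ => (hint k).re).symm
  refine Finset.sum_congr rfl fun k _ => ?_
  refine Eq.trans ?_ (integral_re (hint k)).symm
  rw [integral_const_mul, RCLike.re_to_complex]
  congr 2
  have hchar := ProbabilityTheory.charFun_gaussianReal (μ := 0) (v := (2 * t).toNNReal)
    (2 * π * k)
  rw [charFun_apply_real, Real.coe_toNNReal _ (by positivity)] at hchar
  have : ∀ y : ℝ, Complex.exp (-(2 * π * k : ℂ) ^ 2 * (0 : ℝ) +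
      2 * π * k * ((x + y : ℝ) : ℂ) * Complex.I) = Complex.exp (2 * π * k * x * Complex.I) *
        Complex.exp (((2 * π * k : ℝ) : ℂ) * y * Complex.I) := by
    intro y
    rw [← Complex.exp_add]
    push_cast
    ring_nf
  simp_rw [this]
  rw [integral_const_mul, hchar, ← Complex.exp_add]
  push_cast
  ring_nf

theorem le_of_le_initial {m : ℝ} (hm : ∀ x, m ≤ heatTrig s c 0 x) {t : ℝ} (ht : 0 ≤ t) (x : ℝ) :
    m ≤ heatTrig s c t x := by
  rw [eq_integral_gaussian s c ht x]
  calc m = ∫ _, m ∂(ProbabilityTheory.gaussianReal 0 (2 * t).toNNReal) := by simp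
    _ ≤ _ := by
      refine integral_mono (integrable_const _) ?_ fun y => hm _
      refine Integrable.of_bound
        ((continuous_space s c 0).comp (continuous_const.add continuous_id)).aestronglyMeasurable
        (∑ k ∈ s, ‖c k‖) (ae_of_all _ fun y => abs_le s c le_rfl _)

/-- Up to its constant term, a trigonometric polynomial has a periodic primitive. -/
theorem sub_const_eq (b : ℂ) (t x : ℝ) :
    heatTrig s (coeffDeriv fun k => if k = 0 then b else c k / (2 * π * k * Complex.I)) t x =
      heatTrig s c t x - if 0 ∈ s then (c 0).re else 0 := by
  have : (if 0 ∈ s then (c 0).re else 0) = ∑ k ∈ s, if k = 0 then (c 0).re else 0 := by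
    simp
  rw [this]
  unfold heatTrig
  rw [← Finset.sum_sub_distrib]
  refine Finset.sum_congr rfl fun k _ => ?_
  rcases eq_or_ne k 0 with rfl | hk
  · simp [coeffDeriv]
  · have : (k : ℂ) ≠ 0 := by exact_mod_cast hk
    have h2 : (2 * π * k * Complex.I : ℂ) ≠ 0 := by simp [this, Real.pi_ne_zero]
    simp only [coeffDeriv, hk, if_false, sub_zero]
    rw [mul_div_cancel₀ _ h2]

theorem integral_coeffDeriv (t : ℝ) : ∫ x in (0:ℝ)..1, heatTrig s (coeffDeriv c) t x = 0 := by
  rw [intervalIntegral.integral_eq_sub_of_hasDerivAt (fun x _ => hasDerivAt_space s c t x)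
    ((continuous_space s _ t).intervalIntegrable 0 1)]
  have := periodic s c t 0
  rw [zero_add] at this
  rw [this, sub_self]

theorem integral_eq (t : ℝ) :
    ∫ x in (0:ℝ)..1, heatTrig s c t x = if 0 ∈ s then (c 0).re else 0 := by
  have h := integral_coeffDeriv s
    (fun k => if k = 0 then 0 else c k / (2 * π * k * Complex.I)) t
  simp_rw [sub_const_eq] at h
  rw [intervalIntegral.integral_sub ((continuous_space s c t).intervalIntegrable 0 1)
    intervalIntegrable_const] at h
  simpa [sub_eq_zero] using h

theorem tendsto_atTop (x : ℝ) :
    Tendsto (fun t => heatTrig s c t x) atTop (𝓝 (if 0 ∈ s then (c 0).re else 0)) := by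
  have : (if 0 ∈ s then (c 0).re else 0) = ∑ k ∈ s, if k = 0 then (c 0).re else 0 := by
    simp
  rw [this]
  refine tendsto_finsetSum _ fun k _ => ?_
  rcases eq_or_ne k 0 with rfl | hk
  · simp
  · rw [if_neg hk]
    have hk' : (k : ℝ) ≠ 0 := by exact_mod_cast hk
    have h1 : Tendsto (fun t : ℝ => Real.exp (-((2 * π * k) ^ 2 * t))) atTop (𝓝 0) :=
      Real.tendsto_exp_neg_atTop_nhds_zero.comp
        (tendsto_id.const_mul_atTop (by positivity))
    have h2 := h1.mul_const (c k * Complex.exp (2 * π * k * x * Complex.I)).re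
    rw [zero_mul] at h2
    refine h2.congr fun t => ?_
    rw [← Complex.re_ofReal_mul, Complex.exp_add]
    push_cast
    ring_nf

end heatTrig

theorem HasDerivAt.rpow_const_of_pos {f : ℝ → ℝ} {f' x : ℝ} (a : ℝ) (hf : HasDerivAt f f' x)
    (hx : 0 < f x) : HasDerivAt (fun y => f y ^ a) (a * f x ^ a * f' / f x) x := by
  convert! hf.rpow_const (p := a) (Or.inl hx.ne') using 1
  rw [Real.rpow_sub_one hx.ne']
  ring

theorem HasDerivAt.rpow_mul_div_of_pos {f g : ℝ → ℝ} {f' g' x : ℝ} (a : ℝ)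
    (hf : HasDerivAt f f' x) (hg : HasDerivAt g g' x) (hx : 0 < f x) :
    HasDerivAt (fun y => a * f y ^ a * g y / f y)
      (a * (a * f x ^ a * f' * g x / f x ^ 2 + f x ^ a * g' / f x - f x ^ a * g x * f' / f x ^ 2))
      x := by
  convert! (((hf.rpow_const_of_pos a hx).const_mul a).mul hg).div hf hx.ne' using 1
  have := hx.ne'
  simp only [Pi.mul_apply]
  field_simp

/-- In terms of `v = r ^ a`, the density `v_x² + L v²`. -/
noncomputable def energyDensity (a L r r₁ : ℝ) : ℝ :=
  (a * r ^ a * r₁ / r) ^ 2 + L * (r ^ a) ^ 2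

theorem continuousOn_energyDensity (a L : ℝ) :
    ContinuousOn (Function.uncurry (energyDensity a L)) (Set.Ioi 0 ×ˢ Set.univ) := by
  rintro ⟨r, r₁⟩ ⟨hr, -⟩
  have hr' : r ≠ 0 := (show 0 < r from hr).ne'
  have h : ContinuousAt (fun q : ℝ × ℝ => q.1 ^ a) (r, r₁) :=
    continuousAt_fst.rpow_const (Or.inl hr')
  refine ContinuousAt.continuousWithinAt ?_
  exact ((((continuousAt_const.mul h).mul continuousAt_snd).div continuousAt_fst hr').pow 2).add
    (continuousAt_const.mul (h.pow 2))

namespace heatTrig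

variable (s : Finset ℤ) (c : ℤ → ℂ)

theorem tendsto_energy {m : ℝ} (hm : 0 < m) (hpos : ∀ x, m ≤ heatTrig s c 0 x) (a L : ℝ)
    {l : Filter ℝ} [l.IsCountablyGenerated] (hl : ∀ᶠ t in l, 0 ≤ t) {r r₁ : ℝ → ℝ}
    (hr : ∀ x, Tendsto (fun t => heatTrig s c t x) l (𝓝 (r x)))
    (hr₁ : ∀ x, Tendsto (fun t => heatTrig s (coeffDeriv c) t x) l (𝓝 (r₁ x)))
    (hr₀ : ∀ x, 0 < r x) :
    Tendsto (fun t => ∫ x in (0:ℝ)..1,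
        energyDensity a L (heatTrig s c t x) (heatTrig s (coeffDeriv c) t x)) l
      (𝓝 (∫ x in (0:ℝ)..1, energyDensity a L (r x) (r₁ x))) := by
  refine tendsto_integral_comp_of_bounded (continuousOn_energyDensity a L) hm
    (M := max (∑ k ∈ s, ‖c k‖) (∑ k ∈ s, ‖coeffDeriv c k‖))
    (fun t => continuous_space s c t) (fun t => continuous_space s _ t) ?_ ?_ ?_
    (fun x _ => hr x) (fun x _ => hr₁ x) (fun x _ => hr₀ x)
  · filter_upwards [hl] with t ht x using le_of_le_initial s c hpos ht x
  · filter_upwards [hl] with t ht x _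
      using (le_abs_self _).trans ((abs_le s c ht x).trans (le_max_left _ _))
  · filter_upwards [hl] with t ht x _ using (abs_le s _ ht x).trans (le_max_right _ _)

theorem hasDerivAt_energy {m : ℝ} (hm : 0 < m) (hpos : ∀ x, m ≤ heatTrig s c 0 x) {a L : ℝ}
    {r r₁ r₂ r₃ : ℝ → ℝ → ℝ} (hr : r = heatTrig s c) (hr₁ : r₁ = heatTrig s (coeffDeriv c))
    (hr₂ : r₂ = heatTrig s (coeffDeriv (coeffDeriv c)))
    (hr₃ : r₃ = heatTrig s (coeffDeriv (coeffDeriv (coeffDeriv c)))) {t : ℝ} (ht : 0 < t) :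
    HasDerivAt (fun t => ∫ x in (0:ℝ)..1, energyDensity a L (r t x) (r₁ t x))
      (∫ x in (0:ℝ)..1, (2 * (a * r t x ^ a * r₁ t x / r t x) *
        (a * (a * r t x ^ a * r₁ t x * r₂ t x / r t x ^ 2 + r t x ^ a * r₃ t x / r t x
          - r t x ^ a * r₂ t x * r₁ t x / r t x ^ 2)) +
        L * (2 * r t x ^ a * (a * r t x ^ a * r₂ t x / r t x)))) t := by
  have hrpos : ∀ t, 0 ≤ t → ∀ x, 0 < r t x := fun t ht x => by
    rw [hr]
    exact hm.trans_le (le_of_le_initial s c hpos ht x)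
  let F' : ℝ → ℝ → ℝ := fun t x => (2 * (a * r t x ^ a * r₁ t x / r t x) *
        (a * (a * r t x ^ a * r₁ t x * r₂ t x / r t x ^ 2 + r t x ^ a * r₃ t x / r t x
          - r t x ^ a * r₂ t x * r₁ t x / r t x ^ 2)) +
        L * (2 * r t x ^ a * (a * r t x ^ a * r₂ t x / r t x)))
  have hF'c : ContinuousOn (Function.uncurry F') (Set.Ici 0 ×ˢ Set.univ) := by
    have c₀ := (continuous_uncurry s c).continuousOn (s := Set.Ici 0 ×ˢ Set.univ)
    have c₁ := (continuous_uncurry s (coeffDeriv c)).continuousOn (s := Set.Ici 0 ×ˢ Set.univ)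
    have c₂ := (continuous_uncurry s (coeffDeriv (coeffDeriv c))).continuousOn
      (s := Set.Ici 0 ×ˢ Set.univ)
    have c₃ := (continuous_uncurry s (coeffDeriv (coeffDeriv (coeffDeriv c)))).continuousOn
      (s := Set.Ici 0 ×ˢ Set.univ)
    rw [← hr] at c₀
    rw [← hr₁] at c₁
    rw [← hr₂] at c₂
    rw [← hr₃] at c₃
    have h1 : ∀ q ∈ Set.Ici (0:ℝ) ×ˢ (Set.univ : Set ℝ), r q.1 q.2 ≠ 0 :=
      fun q hq => (hrpos q.1 hq.1 q.2).ne'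
    have h2 : ∀ q ∈ Set.Ici (0:ℝ) ×ˢ (Set.univ : Set ℝ), r q.1 q.2 ^ 2 ≠ 0 :=
      fun q hq => pow_ne_zero 2 (h1 q hq)
    have h3 := c₀.rpow_const (p := a) fun q hq => Or.inl (h1 q hq)
    simp only [F', Function.uncurry_def]
    fun_prop (disch := assumption)
  obtain ⟨C, hC⟩ := (isCompact_Icc.prod isCompact_Icc).exists_bound_of_continuousOn
    (f := Function.uncurry F') (s := Set.Icc (t / 2) (2 * t) ×ˢ Set.Icc 0 1)
    (hF'c.mono (Set.prod_mono (fun u hu => (half_pos ht).le.trans hu.1) (Set.subset_univ _)))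
  have hsub : Set.uIoc (0:ℝ) 1 ⊆ Set.Icc 0 1 := by
    rw [Set.uIoc_of_le zero_le_one]
    exact Set.Ioc_subset_Icc_self
  have hcont : ∀ t, 0 ≤ t → Continuous fun x => energyDensity a L (r t x) (r₁ t x) :=
    fun t ht => (continuousOn_energyDensity a L).comp_continuous
      (f := fun x => (r t x, r₁ t x))
      (by rw [hr, hr₁]; exact (continuous_space s _ t).prodMk (continuous_space s _ t))
      fun x => ⟨hrpos t ht x, trivial⟩
  have hF't : Continuous (F' t) :=
    hF'c.comp_continuous (f := fun x => (t, x)) (by fun_prop) fun x => ⟨ht.le, trivial⟩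
  refine (intervalIntegral.hasDerivAt_integral_of_dominated_loc_of_deriv_le (F' := F')
    (bound := fun _ => C) (Icc_mem_nhds (half_lt_self ht) (by linarith : t < 2 * t)) ?_
    ((hcont t ht.le).intervalIntegrable 0 1) hF't.aestronglyMeasurable ?_
    intervalIntegrable_const ?_).2
  · filter_upwards [lt_mem_nhds ht] with u hu using (hcont u hu.le).aestronglyMeasurable
  · exact ae_of_all _ fun x hx u hu => hC (u, x) ⟨hu, hsub hx⟩
  · refine ae_of_all _ fun x _ u hu => ?_
    have hu0 : 0 ≤ u := (half_pos ht).le.trans hu.1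
    have d₀ : HasDerivAt (fun u => r u x) (r₂ u x) u := by
      rw [hr, hr₂]
      exact hasDerivAt_time s c u x
    have d₁ : HasDerivAt (fun u => r₁ u x) (r₃ u x) u := by
      rw [hr₁, hr₃]
      exact hasDerivAt_time s _ u x
    have hx := hrpos u hu0 x
    convert! ((d₀.rpow_mul_div_of_pos a d₁ hx).fun_pow 2).add
      (((d₀.rpow_const_of_pos a hx).fun_pow 2).const_mul L) using 1
    simp only [F']
    ring

theorem antitoneOn_energy {m : ℝ} (hm : 0 < m) (hpos : ∀ x, m ≤ heatTrig s c 0 x) {p L : ℝ}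
    (hp : 1 ≤ p) (hL : L * (p - 2) = 4 * π ^ 2) :
    AntitoneOn (fun t => ∫ x in (0:ℝ)..1,
        energyDensity (1 / p) L (heatTrig s c t x) (heatTrig s (coeffDeriv c) t x))
      (Set.Ici 0) := by
  have hrpos : ∀ t, 0 ≤ t → ∀ x, 0 < heatTrig s c t x :=
    fun t ht x => hm.trans_le (le_of_le_initial s c hpos ht x)
  have hderiv := fun t ht => hasDerivAt_energy s c hm hpos (a := 1 / p) (L := L)
    rfl rfl rfl rfl (t := t) ht
  refine antitoneOn_of_deriv_nonpos (convex_Ici 0) ?_ ?_ ?_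
  · intro t ht
    have hsp : ∀ (b : ℤ → ℂ) x,
        Tendsto (fun t => heatTrig s b t x) (𝓝[Set.Ici 0] t) (𝓝 (heatTrig s b t x)) :=
      fun b x => (hasDerivAt_time s b t x).continuousAt.tendsto.mono_left nhdsWithin_le_nhds
    exact tendsto_energy s c hm hpos (1 / p) L self_mem_nhdsWithin (hsp c) (hsp _) (hrpos t ht)
  · intro t ht
    rw [interior_Ici] at ht
    exact (hderiv t ht).differentiableAt.differentiableWithinAt
  · intro t ht
    rw [interior_Ici] at ht
    rw [(hderiv t ht).deriv]
    have hr := hrpos t (le_of_lt ht)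
    have hp0 : p ≠ 0 := by linarith
    have c₀ := continuous_space s c t
    have c₁ := continuous_space s (coeffDeriv c) t
    have c₂ := continuous_space s (coeffDeriv (coeffDeriv c)) t
    have c₃ := continuous_space s (coeffDeriv (coeffDeriv (coeffDeriv c))) t
    have d₀ := hasDerivAt_space s c t
    have d₁ := hasDerivAt_space s (coeffDeriv c) t
    have d₂ := hasDerivAt_space s (coeffDeriv (coeffDeriv c)) t
    have hend : ∀ b : ℤ → ℂ, heatTrig s b t 0 = heatTrig s b t 1 := fun b => by
      simpa using (periodic s b t 0).symm
    have h1 := fun x => (hr x).ne'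
    have h2 := fun x => pow_ne_zero 2 (h1 x)
    have h3 : Continuous fun x => heatTrig s c t x ^ (1 / p) :=
      c₀.rpow_const fun x => Or.inl (h1 x)
    refine dissipation_nonpos hp hL (fun x => Real.rpow_pos_of_pos (hr x) (1 / p))
      (fun x => (d₀ x).rpow_const_of_pos _ (hr x))
      (fun x => (d₀ x).rpow_mul_div_of_pos _ (d₁ x) (hr x))
      (fun x => (d₀ x).rpow_mul_div_of_pos _ (d₂ x) (hr x))
      (by fun_prop (disch := assumption)) (by fun_prop (disch := assumption)) ?_ ?_ ?_ ?_
    · intro x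
      have := (Real.rpow_pos_of_pos (hr x) (1 / p)).ne'
      have := h1 x
      generalize heatTrig s c t x ^ (1 / p) = V at *
      field_simp
      ring
    all_goals simp only [hend]

theorem energy_ge {m : ℝ} (hm : 0 < m) (hpos : ∀ x, m ≤ heatTrig s c 0 x) {p L : ℝ}
    (hp : 1 ≤ p) (hL : L * (p - 2) = 4 * π ^ 2) :
    L * ((∫ x in (0:ℝ)..1, heatTrig s c 0 x) ^ (1 / p)) ^ 2 ≤ ∫ x in (0:ℝ)..1,
      energyDensity (1 / p) L (heatTrig s c 0 x) (heatTrig s (coeffDeriv c) 0 x) := by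
  have hanti := antitoneOn_energy s c hm hpos hp hL
  have hI := integral_eq s c 0
  have hIpos : 0 < ∫ x in (0:ℝ)..1, heatTrig s c 0 x :=
    intervalIntegral.intervalIntegral_pos_of_pos
      ((continuous_space s c 0).intervalIntegrable 0 1) (fun x => hm.trans_le (hpos x)) zero_lt_one
  have hlim := tendsto_energy s c hm hpos (1 / p) L (l := atTop) (eventually_ge_atTop 0)
    (tendsto_atTop s c) (tendsto_atTop s (coeffDeriv c)) (fun _ => hI ▸ hIpos)
  have hle := le_of_tendsto hlim (b := ∫ x in (0:ℝ)..1,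
      energyDensity (1 / p) L (heatTrig s c 0 x) (heatTrig s (coeffDeriv c) 0 x)) (by
    filter_upwards [eventually_ge_atTop 0] with t ht
    exact hanti Set.self_mem_Ici ht ht)
  rw [← hI] at hle
  simpa [energyDensity, coeffDeriv] using hle

end heatTrig

theorem exists_heatTrig_near {g : ℝ → ℝ} (hg : Continuous g) (hper : Function.Periodic g 1)
    {ε : ℝ} (hε : 0 < ε) : ∃ s c, ∀ x, |heatTrig s c 0 x - g x| ≤ ε := by
  let G : C(AddCircle (1:ℝ), ℂ) :=
    ⟨fun x => (hper.lift x : ℂ), by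
      refine Complex.continuous_ofReal.comp ?_
      exact continuous_quot_lift _ hg⟩
  have hG : ∀ x : ℝ, G x = g x := fun x => rfl
  have : Fact ((0:ℝ) < 1) := ⟨zero_lt_one⟩
  have hmem : G ∈ (Submodule.span ℂ (Set.range (@fourier (1:ℝ)))).topologicalClosure := by
    rw [span_fourier_closure_eq_top]
    trivial
  obtain ⟨P, hP, hd⟩ := Metric.mem_closure_iff.1 hmem ε hε
  obtain ⟨b, rfl⟩ := Finsupp.mem_span_range_iff_exists_finsupp.1 hP
  refine ⟨b.support, b, fun x => ?_⟩
  have h1 : heatTrig b.support b 0 x - g x = ((b.sum fun i a => a • fourier i) (x : AddCircle (1:ℝ))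
      - G x).re := by
    rw [hG, Finsupp.sum, ContinuousMap.sum_apply, Complex.sub_re, Complex.re_sum, heatTrig,
      Complex.ofReal_re]
    congr 1
    refine Finset.sum_congr rfl fun k _ => ?_
    rw [ContinuousMap.smul_apply, smul_eq_mul, fourier_coe_apply]
    congr 3
    push_cast
    ring
  rw [h1]
  refine (Complex.abs_re_le_norm _).trans ?_
  rw [← dist_eq_norm, dist_comm]
  exact (ContinuousMap.dist_apply_le_dist _).trans hd.le

theorem exists_heatTrig_near_C1 {f f' : ℝ → ℝ} (hf : ∀ x, HasDerivAt f (f' x) x)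
    (hf' : Continuous f') (hper : Function.Periodic f 1) {ε : ℝ} (hε : 0 < ε) :
    ∃ s c, ∀ x, |heatTrig s c 0 x - f x| ≤ ε ∧ |heatTrig s (coeffDeriv c) 0 x - f' x| ≤ ε := by
  have hper' : Function.Periodic f' 1 := fun x =>
    (((hf (x + 1)).comp_add_const x 1).congr_of_eventuallyEq
      (Eventually.of_forall fun y => (hper y).symm)).unique (hf x)
  obtain ⟨s, b, hb⟩ := exists_heatTrig_near hf' hper' (half_pos hε)
  obtain ⟨s, hs, b, hb⟩ : ∃ s : Finset ℤ, 0 ∈ s ∧ ∃ b, ∀ x, |heatTrig s b 0 x - f' x| ≤ ε / 2 := by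
    classical
    refine ⟨insert 0 s, Finset.mem_insert_self _ _, fun k => if k ∈ s then b k else 0, fun x => ?_⟩
    convert! hb x using 3
    unfold heatTrig
    rw [← Finset.sum_subset (Finset.subset_insert 0 s)]
    · exact Finset.sum_congr rfl fun k hk => by simp only [if_pos hk]
    · intro k _ hk
      simp [hk]
  have hfi : ∫ x in (0:ℝ)..1, f' x = 0 := by
    rw [intervalIntegral.integral_eq_sub_of_hasDerivAt (fun x _ => hf x)
      (hf'.intervalIntegrable 0 1)]
    simpa [sub_eq_zero] using hper 0
  have hmean : |if 0 ∈ s then (b 0).re else 0| ≤ ε / 2 := by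
    have h := intervalIntegral.norm_integral_le_of_norm_le_const (a := 0) (b := 1)
      (f := fun x => heatTrig s b 0 x - f' x) fun x _ => hb x
    rw [intervalIntegral.integral_sub ((heatTrig.continuous_space s b 0).intervalIntegrable 0 1)
      (hf'.intervalIntegrable 0 1), hfi, heatTrig.integral_eq] at h
    simpa using h
  let c₀ : ℂ → ℤ → ℂ := fun z k => if k = 0 then z else b k / (2 * π * k * Complex.I)
  have hshift : ∀ (z : ℂ) x, heatTrig s (c₀ z) 0 x = heatTrig s (c₀ 0) 0 x + z.re := by
    intro z x
    have : z.re = ∑ k ∈ s, if k = 0 then z.re else 0 := by simp [hs]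
    rw [this]
    unfold heatTrig
    rw [← Finset.sum_add_distrib]
    refine Finset.sum_congr rfl fun k _ => ?_
    rcases eq_or_ne k 0 with rfl | hk
    · simp [c₀]
    · simp [c₀, hk]
  let z : ℂ := ((f 0 - heatTrig s (c₀ 0) 0 0 : ℝ) : ℂ)
  have h0 : heatTrig s (c₀ z) 0 0 - f 0 = 0 := by
    rw [hshift]
    simp [z]
  have hD : ∀ x, |heatTrig s (coeffDeriv (c₀ z)) 0 x - f' x| ≤ ε := by
    intro x
    have := heatTrig.sub_const_eq s b z 0 x
    rw [this]
    calc _ = |(heatTrig s b 0 x - f' x) - if 0 ∈ s then (b 0).re else 0| := by ring_nf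
      _ ≤ ε / 2 + ε / 2 := (abs_sub _ _).trans (add_le_add (hb x) hmean)
      _ = ε := add_halves ε
  refine ⟨s, c₀ z, fun x => ⟨?_, hD x⟩⟩
  have hp2 : Function.Periodic (fun x => heatTrig s (c₀ z) 0 x - f x) 1 :=
    (heatTrig.periodic s _ 0).sub hper
  obtain ⟨y, hy, hxy⟩ := hp2.exists_mem_Ico₀ zero_lt_one x
  rw [hxy]
  have := Convex.norm_image_sub_le_of_norm_hasDerivWithin_le (s := Set.univ) (x := 0) (y := y)
    (f := fun x => heatTrig s (c₀ z) 0 x - f x)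
    (fun x _ => ((heatTrig.hasDerivAt_space s (c₀ z) 0 x).sub (hf x)).hasDerivWithinAt)
    (fun x _ => hD x) convex_univ trivial trivial
  rw [h0, sub_zero, sub_zero] at this
  refine this.trans (mul_le_of_le_one_right hε.le ?_)
  rw [Real.norm_eq_abs, abs_of_nonneg hy.1]
  exact hy.2.le

theorem energy_ge_of_periodic {f f' : ℝ → ℝ} (hf : ∀ x, HasDerivAt f (f' x) x)
    (hf' : Continuous f') (hper : Function.Periodic f 1) {m : ℝ} (hm : 0 < m) (hfm : ∀ x, m ≤ f x)
    {p L : ℝ} (hp : 1 ≤ p) (hL : L * (p - 2) = 4 * π ^ 2) :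
    L * ((∫ x in (0:ℝ)..1, f x) ^ (1 / p)) ^ 2 ≤
      ∫ x in (0:ℝ)..1, energyDensity (1 / p) L (f x) (f' x) := by
  have hfc : Continuous f := continuous_iff_continuousAt.2 fun x => (hf x).continuousAt
  have hu : ∀ n : ℕ, 0 < m / 2 * (1 / ((n : ℝ) + 1)) := fun n => by positivity
  choose s c h using fun n : ℕ => exists_heatTrig_near_C1 hf hf' hper (hu n)
  have hu0 : Tendsto (fun n : ℕ => m / 2 * (1 / ((n : ℝ) + 1))) atTop (𝓝 0) := by
    simpa using tendsto_one_div_add_atTop_nhds_zero_nat.const_mul (m / 2)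
  have hum : ∀ n : ℕ, m / 2 * (1 / ((n : ℝ) + 1)) ≤ m / 2 := fun n => by
    refine mul_le_of_le_one_right (half_pos hm).le ?_
    rw [div_le_one (by positivity)]
    linarith [n.cast_nonneg (α := ℝ)]
  have hpos : ∀ n x, m / 2 ≤ heatTrig (s n) (c n) 0 x := fun n x => by
    linarith [(abs_le.1 (h n x).1).1, hum n, hfm x]
  obtain ⟨A, hA⟩ := isCompact_Icc.exists_bound_of_continuousOn (s := Set.Icc (0:ℝ) 1)
    hfc.continuousOn
  obtain ⟨B, hB⟩ := isCompact_Icc.exists_bound_of_continuousOn (s := Set.Icc (0:ℝ) 1)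
    hf'.continuousOn
  have htend : ∀ {Φ : ℝ → ℝ → ℝ},
      ContinuousOn (Function.uncurry Φ) (Set.Ioi 0 ×ˢ Set.univ) →
      Tendsto (fun n => ∫ x in (0:ℝ)..1,
        Φ (heatTrig (s n) (c n) 0 x) (heatTrig (s n) (coeffDeriv (c n)) 0 x)) atTop
        (𝓝 (∫ x in (0:ℝ)..1, Φ (f x) (f' x))) := by
    intro Φ hΦ
    refine tendsto_integral_comp_of_bounded hΦ (half_pos hm) (M := max A B + m / 2)
      (fun n => heatTrig.continuous_space _ _ _) (fun n => heatTrig.continuous_space _ _ _)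
      (Eventually.of_forall hpos) (Eventually.of_forall fun n x hx => ?_)
      (Eventually.of_forall fun n x hx => ?_) (fun x _ => ?_) (fun x _ => ?_)
      (fun x _ => hm.trans_le (hfm x))
    · linarith [(abs_le.1 (h n x).1).2, hum n, (abs_le.1 (hA x hx)).2, le_max_left A B]
    · rw [abs_le]
      constructor <;> linarith [(abs_le.1 (h n x).2).1, (abs_le.1 (h n x).2).2, hum n,
        (abs_le.1 (hB x hx)).1, (abs_le.1 (hB x hx)).2, le_max_right A B]
    · exact tendsto_iff_dist_tendsto_zero.2 (squeeze_zero (fun _ => dist_nonneg)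
        (fun n => (h n x).1) hu0)
    · exact tendsto_iff_dist_tendsto_zero.2 (squeeze_zero (fun _ => dist_nonneg)
        (fun n => (h n x).2) hu0)
  have h1 := htend (Φ := fun a _ => a) continuousOn_fst
  have hpos' : 0 < ∫ x in (0:ℝ)..1, f x :=
    intervalIntegral.intervalIntegral_pos_of_pos
      (hfc.intervalIntegrable 0 1) (fun x => hm.trans_le (hfm x)) zero_lt_one
  exact le_of_tendsto_of_tendsto' (((h1.rpow_const (Or.inl hpos'.ne')).pow 2).const_mul L)
    (htend (continuousOn_energyDensity (1 / p) L))
    fun n => heatTrig.energy_ge (s n) (c n) (half_pos hm) (hpos n) hp hL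

theorem interpolation_of_pos {v v' : ℝ → ℝ} (hv : ∀ x, HasDerivAt v (v' x) x)
    (hv' : Continuous v') (hper : Function.Periodic v 1) {m : ℝ} (hm : 0 < m) (hvm : ∀ x, m ≤ v x)
    {p L : ℝ} (hp : 1 ≤ p) (hL : L * (p - 2) = 4 * π ^ 2) :
    L * (∫ x in (0:ℝ)..1, v x ^ p) ^ (2 / p) ≤
      (∫ x in (0:ℝ)..1, v' x ^ 2) + L * ∫ x in (0:ℝ)..1, v x ^ 2 := by
  have hpos : ∀ x, 0 < v x := fun x => hm.trans_le (hvm x)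
  have hvc : Continuous v := continuous_iff_continuousAt.2 fun x => (hv x).continuousAt
  have hp0 : p ≠ 0 := by linarith
  have hne := fun x => (hpos x).ne'
  have hpc : Continuous fun x => v x ^ p := hvc.rpow_const fun x => Or.inl (hne x)
  have h := energy_ge_of_periodic (fun x => (hv x).rpow_const_of_pos p (hpos x))
    (by fun_prop (disch := assumption)) (fun x => by simp only [hper x]) (Real.rpow_pos_of_pos hm p)
    (fun x => Real.rpow_le_rpow hm.le (hvm x) (by linarith)) hp hL
  have hI : 0 ≤ ∫ x in (0:ℝ)..1, v x ^ p :=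
    intervalIntegral.integral_nonneg zero_le_one fun x _ => (Real.rpow_pos_of_pos (hpos x) p).le
  have hden : ∀ x, energyDensity (1 / p) L (v x ^ p) (p * v x ^ p * v' x / v x) =
      v' x ^ 2 + L * v x ^ 2 := by
    intro x
    have h1 := hne x
    have h2 := (Real.rpow_pos_of_pos (hpos x) p).ne'
    rw [energyDensity, ← Real.rpow_mul (hpos x).le, mul_one_div_cancel hp0, Real.rpow_one]
    field_simp
  simp_rw [hden] at h
  rw [intervalIntegral.integral_add
    ((by fun_prop : Continuous fun x => v' x ^ 2).intervalIntegrable 0 1)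
    ((by fun_prop : Continuous fun x => L * v x ^ 2).intervalIntegrable 0 1),
    intervalIntegral.integral_const_mul, ← Real.rpow_natCast, ← Real.rpow_mul hI] at h
  convert! h using 3
  push_cast
  ring

/-- Interpolation inequality on the circle of circumference 1, with the optimal
constant λ₁ = 4π²: for p ∈ (1,2) ∪ (2,∞) and every C¹ 1-periodic v,
∫₀¹ (v')² ≥ (4π²/(p−2))[(∫₀¹ |v|^p)^{2/p} − ∫₀¹ v²]. -/
theorem interpolation_inequality_circle (p : ℝ)
    (hp : p ∈ Set.Ioo 1 2 ∪ Set.Ioi 2)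
    (v : ℝ → ℝ) (hv : ContDiff ℝ 1 v) (hper : Function.Periodic v 1) :
    ∫ x in (0:ℝ)..1, (deriv v x) ^ 2
      ≥ (4 * π ^ 2 / (p - 2)) *
        ((∫ x in (0:ℝ)..1, |v x| ^ p) ^ (2 / p) - ∫ x in (0:ℝ)..1, (v x) ^ 2) := by
  have hp1 : 1 ≤ p := by
    rcases hp with h | h
    · exact h.1.le
    · exact one_le_two.trans (le_of_lt h)
  have hp2 : p - 2 ≠ 0 := by
    rcases hp with h | h
    · exact (sub_neg.2 h.2).ne
    · exact (sub_pos.2 h).ne'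
  set L := 4 * π ^ 2 / (p - 2)
  have hL : L * (p - 2) = 4 * π ^ 2 := div_mul_cancel₀ _ hp2
  have hd : ∀ x, HasDerivAt v (deriv v x) x := fun x =>
    (hv.differentiable one_ne_zero x).hasDerivAt
  have hc := hv.continuous
  have hdc : Continuous (deriv v) := hv.continuous_deriv_one
  have hstep : ∀ ε ∈ Set.Ioi (0:ℝ),
      L * (∫ x in (0:ℝ)..1, √(v x ^ 2 + ε ^ 2) ^ p) ^ (2 / p) ≤
      (∫ x in (0:ℝ)..1, deriv v x ^ 2) + L * ∫ x in (0:ℝ)..1, √(v x ^ 2 + ε ^ 2) ^ 2 := by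
    intro ε hε
    have hε : 0 < ε := hε
    have hpos : ∀ x, 0 < v x ^ 2 + ε ^ 2 := fun x => by positivity
    have hne : ∀ x, √(v x ^ 2 + ε ^ 2) ≠ 0 := fun x => (Real.sqrt_pos.2 (hpos x)).ne'
    have hderiv : ∀ x, HasDerivAt (fun x => √(v x ^ 2 + ε ^ 2))
        (v x * deriv v x / √(v x ^ 2 + ε ^ 2)) x := by
      intro x
      convert! (((hd x).fun_pow 2).add_const (ε ^ 2)).sqrt (hpos x).ne' using 1
      have := hne x
      field_simp
      ring
    have hcd : Continuous fun x => v x * deriv v x / √(v x ^ 2 + ε ^ 2) := by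
      fun_prop (disch := assumption)
    refine (interpolation_of_pos hderiv hcd (fun x => by simp only [hper x]) hε
      (fun x => Real.le_sqrt_of_sq_le (by nlinarith [sq_nonneg (v x)])) hp1 hL).trans ?_
    gcongr ?_ + _
    refine intervalIntegral.integral_mono_on zero_le_one
      ((hcd.pow 2).intervalIntegrable 0 1) ((hdc.pow 2).intervalIntegrable 0 1) fun x _ => ?_
    rw [div_pow, Real.sq_sqrt (hpos x).le, div_le_iff₀ (hpos x)]
    nlinarith [mul_nonneg (sq_nonneg (deriv v x)) (sq_nonneg ε)]
  have hlim : ∀ q : ℝ, 0 ≤ q → Tendsto (fun ε => ∫ x in (0:ℝ)..1, √(v x ^ 2 + ε ^ 2) ^ q)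
      (𝓝[>] 0) (𝓝 (∫ x in (0:ℝ)..1, |v x| ^ q)) := by
    intro q hq
    have : Continuous fun ε : ℝ => ∫ x in (0:ℝ)..1, √(v x ^ 2 + ε ^ 2) ^ q := by
      refine intervalIntegral.continuous_parametric_intervalIntegral_of_continuous' ?_ 0 1
      refine Continuous.rpow_const ?_ fun _ => Or.inr hq
      fun_prop
    have h := this.tendsto 0
    simp only [ne_eq, OfNat.ofNat_ne_zero, not_false_eq_true, zero_pow, add_zero,
      Real.sqrt_sq_eq_abs] at h
    exact h.mono_left nhdsWithin_le_nhds
  have h2 := hlim 2 zero_le_two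
  simp only [Real.rpow_two, sq_abs] at h2
  have hfinal := le_of_tendsto_of_tendsto
    (((hlim p (by linarith)).rpow_const (Or.inr (by positivity))).const_mul L)
    ((h2.const_mul L).const_add _) (eventually_of_mem self_mem_nhdsWithin hstep)
  linarith
end

section
/- Let p ∈ (1,2) ∪ (2,∞) and let λ be a real number with 0 < λ < 4π². If v : ℝ → ℝ is a twice continuously differentiable, 1-periodic function with v(x) > 0 for all x, satisfying −v''(x) + (λ/(p−2))·(v(x) − v(x)^{p−1}) = 0 for all x ∈ ℝ, then v is identically equal to 1. -/
open Real

/-- Poincaré's inequality on an interval of length `1/2`, for functions vanishing at both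
endpoints. -/
lemma poincare_dirichlet_half {f f' : ℝ → ℝ} (hf : ∀ x, HasDerivAt f (f' x) x)
    (hf' : Continuous f') {μ : ℝ} (hμ0 : 0 < μ) (hμ : μ < 2 * π) {a : ℝ}
    (ha : f a = 0) (hb : f (a + 1 / 2) = 0) :
    μ ^ 2 * ∫ x in a..(a + 1 / 2), f x ^ 2 ≤ ∫ x in a..(a + 1 / 2), f' x ^ 2 := by
  have hfc : Continuous f := continuous_iff_continuousAt.2 fun x => (hf x).continuousAt
  have hcos : ∀ x ∈ Set.uIcc a (a + 1 / 2), 0 < cos (μ * (x - (a + 1 / 4))) := by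
    intro x hx
    rw [Set.uIcc_of_le (by linarith)] at hx
    apply cos_pos_of_mem_Ioo
    constructor <;> nlinarith [hx.1, hx.2, pi_pos]
  set T : ℝ → ℝ := fun x => sin (μ * (x - (a + 1 / 4))) / cos (μ * (x - (a + 1 / 4))) with hT
  have hTc : ContinuousOn T (Set.uIcc a (a + 1 / 2)) :=
    ContinuousOn.div (by fun_prop) (by fun_prop) fun x hx => (hcos x hx).ne'
  have hTd : ∀ x ∈ Set.uIcc a (a + 1 / 2), HasDerivAt T (μ * (1 + T x ^ 2)) x := by
    intro x hx
    have h0 : HasDerivAt (fun x => μ * (x - (a + 1 / 4))) μ x := by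
      simpa using ((hasDerivAt_id x).sub_const (a + 1 / 4)).const_mul μ
    refine (h0.sin.div h0.cos (hcos x hx).ne').congr_deriv ?_
    have := (hcos x hx).ne'
    simp only [hT]
    generalize μ * (x - (a + 1 / 4)) = t at this ⊢
    field_simp
    ring
  have hsum : ∫ x in a..(a + 1 / 2), ((f' x + μ * T x * f x) ^ 2 - (f' x ^ 2 - μ ^ 2 * f x ^ 2))
      = 0 := by
    rw [intervalIntegral.integral_eq_sub_of_hasDerivAt (f := fun x => μ * T x * f x ^ 2)]
    · simp only [ha, hb]
      ring
    · intro x hx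
      refine (((hTd x hx).const_mul μ).mul ((hf x).pow 2)).congr_deriv ?_
      simp only [Pi.pow_apply]
      ring
    · apply ContinuousOn.intervalIntegrable
      fun_prop
  have hi1 : IntervalIntegrable (fun x => (f' x + μ * T x * f x) ^ 2) MeasureTheory.volume
      a (a + 1 / 2) := by
    apply ContinuousOn.intervalIntegrable
    fun_prop
  have hi2 : IntervalIntegrable (fun x => f' x ^ 2) MeasureTheory.volume a (a + 1 / 2) :=
    (by fun_prop : Continuous _).intervalIntegrable _ _
  have hi3 : IntervalIntegrable (fun x => μ ^ 2 * f x ^ 2) MeasureTheory.volume a (a + 1 / 2) :=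
    (by fun_prop : Continuous _).intervalIntegrable _ _
  rw [intervalIntegral.integral_sub hi1 (hi2.sub hi3), intervalIntegral.integral_sub hi2 hi3,
    intervalIntegral.integral_const_mul] at hsum
  have hnn : 0 ≤ ∫ x in a..(a + 1 / 2), (f' x + μ * T x * f x) ^ 2 :=
    intervalIntegral.integral_nonneg (by linarith) fun x _ => sq_nonneg _
  linarith

/-- Wirtinger's inequality for `1`-periodic functions of mean zero, with any constant below the
optimal one, on the period starting at a suitable point. -/
lemma wirtinger_periodic {w w' : ℝ → ℝ} (hw : ∀ x, HasDerivAt w (w' x) x)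
    (hw' : Continuous w') (hper : Function.Periodic w 1) (hmean : ∀ a, ∫ x in a..(a + 1), w x = 0)
    {μ : ℝ} (hμ0 : 0 < μ) (hμ : μ < 2 * π) :
    ∃ a, μ ^ 2 * ∫ x in a..(a + 1), w x ^ 2 ≤ ∫ x in a..(a + 1), w' x ^ 2 := by
  have hwc : Continuous w := continuous_iff_continuousAt.2 fun x => (hw x).continuousAt
  obtain ⟨a, ha⟩ : ∃ a, w a = w (a + 1 / 2) := by
    have hd : Continuous fun x => w x - w (x + 1 / 2) := by fun_prop
    have h1 : w (1 / 2 + 1 / 2) = w 0 := by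
      rw [← hper 0]; norm_num
    obtain ⟨a, ha⟩ : (0 : ℝ) ∈ Set.range fun x => w x - w (x + 1 / 2) := by
      rcases le_total (w 0) (w (0 + 1 / 2)) with h | h
      · refine mem_range_of_exists_le_of_exists_ge hd ⟨0, by linarith⟩ ⟨1 / 2, ?_⟩
        rw [h1]; rw [zero_add] at h; linarith
      · refine mem_range_of_exists_le_of_exists_ge hd ⟨1 / 2, ?_⟩ ⟨0, by linarith⟩
        rw [h1]; rw [zero_add] at h; linarith
    exact ⟨a, sub_eq_zero.1 ha⟩
  refine ⟨a, ?_⟩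
  have hf : ∀ x, HasDerivAt (fun x => w x - w a) (w' x) x := fun x => (hw x).sub_const _
  have key1 := poincare_dirichlet_half hf hw' hμ0 hμ (a := a) (sub_self _)
    (sub_eq_zero.2 ha.symm)
  have key2 := poincare_dirichlet_half hf hw' hμ0 hμ (a := a + 1 / 2)
    (sub_eq_zero.2 ha.symm)
    (by rw [show a + 1 / 2 + 1 / 2 = a + 1 by ring, hper a, sub_self])
  rw [show a + 1 / 2 + 1 / 2 = a + 1 by ring] at key2
  have hint : ∀ {g : ℝ → ℝ}, Continuous g → ∀ b c, IntervalIntegrable g MeasureTheory.volume b c :=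
    fun hg b c => hg.intervalIntegrable b c
  rw [← intervalIntegral.integral_add_adjacent_intervals (b := a + 1 / 2)
    (hint (g := fun x => w' x ^ 2) (by fun_prop) _ _) (hint (by fun_prop) _ _)]
  have hadd := intervalIntegral.integral_add_adjacent_intervals (μ := MeasureTheory.volume)
    (hint (g := fun x => (w x - w a) ^ 2) (by fun_prop) a (a + 1 / 2)) (hint (by fun_prop) _ (a + 1))
  have hexp : ∫ x in a..(a + 1), (w x - w a) ^ 2 = (∫ x in a..(a + 1), w x ^ 2) + w a ^ 2 := by
    have : ∀ x, (w x - w a) ^ 2 = (w x ^ 2 - 2 * w a * w x) + w a ^ 2 := fun x => by ring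
    simp only [this]
    rw [intervalIntegral.integral_add (hint (by fun_prop) _ _) (hint (by fun_prop) _ _),
      intervalIntegral.integral_sub (hint (by fun_prop) _ _) (hint (by fun_prop) _ _),
      intervalIntegral.integral_const_mul, hmean]
    simp
  nlinarith [mul_nonneg (sq_nonneg μ) (sq_nonneg (w a))]

/-- Rigidity on the circle of circumference 1: for p ∈ (1,2) ∪ (2,∞) and
0 < λ < 4π², any positive C² 1-periodic solution of
−v'' + (λ/(p−2))(v − v^{p−1}) = 0 is identically 1. -/
theorem rigidity_circle (p : ℝ) (hp : p ∈ Set.Ioo 1 2 ∪ Set.Ioi 2)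
    (lam : ℝ) (hlam0 : 0 < lam) (hlam1 : lam < 4 * π ^ 2)
    (v : ℝ → ℝ) (hv : ContDiff ℝ 2 v) (hper : Function.Periodic v 1)
    (hpos : ∀ x, 0 < v x)
    (heq : ∀ x : ℝ, - deriv (deriv v) x + (lam / (p - 2)) * (v x - v x ^ (p - 1)) = 0) :
    ∀ x : ℝ, v x = 1 := by
  have hp1 : 1 < p := by
    rcases hp with h | h
    · exact h.1
    · exact one_lt_two.trans h
  have hp2 : p - 2 ≠ 0 := by
    rcases hp with h | h
    · exact (sub_neg.2 h.2).ne
    · exact (sub_pos.2 h).ne'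
  set w := deriv v with hw_def
  set z := deriv w with hz_def
  have hw1 : ContDiff ℝ 1 w := ((contDiff_succ_iff_deriv (n := 1)).1 hv).2.2
  have hvd : ∀ x, HasDerivAt v (w x) x := fun x =>
    (hv.differentiable (by norm_num) x).hasDerivAt
  have hwd : ∀ x, HasDerivAt w (z x) x := fun x =>
    (hw1.differentiable (by norm_num) x).hasDerivAt
  have hzc : Continuous z := hw1.continuous_deriv le_rfl
  have hvc : Continuous v := hv.continuous
  have hwc : Continuous w := hw1.continuous
  have hwper : Function.Periodic w 1 := fun x => by
    rw [hw_def, ← deriv_comp_add_const, hper.funext]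
  set c := lam / (p - 2) with hc
  have hcl : c * (p - 2) = lam := div_mul_cancel₀ _ hp2
  have hz : ∀ x, z x = c * (v x - v x ^ (p - 1)) := fun x => by linarith [heq x]
  have hmean : ∀ a, ∫ x in a..(a + 1), w x = 0 := fun a => by
    rw [intervalIntegral.integral_eq_sub_of_hasDerivAt (fun x _ => hvd x)
      (hwc.intervalIntegrable _ _), hper a, sub_self]
  have hint : ∀ a, IntervalIntegrable
      (fun x => z x ^ 2 + (p - 1) / 3 * (w x ^ 4 / v x ^ 2) - lam * w x ^ 2)
      MeasureTheory.volume a (a + 1) := fun a =>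
    (((hzc.pow 2).add (((hwc.pow 4).div (hvc.pow 2) fun x =>
      (pow_pos (hpos x) 2).ne').const_mul _)).sub ((hwc.pow 2).const_mul _)).intervalIntegrable _ _
  -- the Bochner-type identity: `z² + (p-1)/3 · w⁴/v² - λ w²` is an exact derivative
  have hident : ∀ a, ∫ x in a..(a + 1),
      (z x ^ 2 + (p - 1) / 3 * (w x ^ 4 / v x ^ 2) - lam * w x ^ 2) = 0 := by
    intro a
    rw [intervalIntegral.integral_eq_sub_of_hasDerivAt
      (f := fun x => c * (v x - v x ^ (p - 1)) * w x - (p - 1) / 3 * (w x ^ 3 / v x))]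
    · simp only [hper a, hwper a, sub_self]
    · intro x _
      have hv0 := (hpos x).ne'
      refine (((((hvd x).sub ((hvd x).rpow_const (p := p - 1) (Or.inl hv0))).const_mul c).mul
        (hwd x)).sub ((((hwd x).pow 3).div (hvd x) hv0).const_mul ((p - 1) / 3))).congr_deriv ?_
      have hr : v x ^ (p - 1) = v x ^ (p - 1 - 1) * v x := by
        rw [← rpow_add_one hv0]; ring_nf
      simp only [Pi.sub_apply, Pi.pow_apply, hz x, hr, ← hcl]
      field_simp
      ring
    · exact hint a
  obtain ⟨μ, hμ1, hμ2⟩ : ∃ μ, √lam < μ ∧ μ < 2 * π := by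
    apply exists_between
    rw [sqrt_lt' (by positivity)]
    linarith
  have hμ0 : 0 < μ := (sqrt_nonneg _).trans_lt hμ1
  have hμl : lam < μ ^ 2 := (sqrt_lt' hμ0).1 hμ1
  obtain ⟨a, hwirt⟩ := wirtinger_periodic hwd hzc hwper hmean hμ0 hμ2
  have hle : ∫ x in a..(a + 1), (z x ^ 2 - lam * w x ^ 2) ≤ 0 := by
    rw [← hident a]
    refine intervalIntegral.integral_mono_on (by linarith)
      ((by fun_prop : Continuous _).intervalIntegrable _ _)
      (hint a) fun x _ => ?_
    have : 0 ≤ (p - 1) / 3 * (w x ^ 4 / v x ^ 2) := by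
      have := sub_pos.2 hp1; positivity
    linarith
  rw [intervalIntegral.integral_sub ((by fun_prop : Continuous _).intervalIntegrable _ _)
    ((by fun_prop : Continuous _).intervalIntegrable _ _),
    intervalIntegral.integral_const_mul] at hle
  have hw2 : ∫ x in a..(a + 1), w x ^ 2 ≤ 0 := by nlinarith
  have hw0 : ∀ x, w x = 0 := by
    intro x
    obtain ⟨y, hy, hxy⟩ := hwper.exists_mem_Ico one_pos x a
    rw [hxy]
    by_contra hne
    have : 0 < ∫ x in a..(a + 1), w x ^ 2 :=
      intervalIntegral.integral_pos (by linarith) (by fun_prop) (fun x _ => sq_nonneg _)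
        ⟨y, Set.Ico_subset_Icc_self hy, by positivity⟩
    linarith
  intro x
  have hz0 : z x = 0 := by
    rw [hz_def, show w = fun _ => 0 from funext hw0, deriv_const]
  have hc0 : c ≠ 0 := div_ne_zero hlam0.ne' hp2
  have hvx : v x ^ (p - 1) = v x ^ (1 : ℝ) := by
    rw [rpow_one]
    have := hz x
    rw [hz0, zero_eq_mul, or_iff_right hc0] at this
    linarith
  by_contra hne
  have := (rpow_right_inj (hpos x) hne).1 hvx
  exact hp2 (by linarith)
end
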